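/- arXiv:1003.1377 — 12 statements merged into one kernel-verified Lean document; each statement's English description precedes it below -/
import Mathlib

section
/- Let h : (0,∞) → ℝ be differentiable. Suppose that for every n ≥ 3, every positive probability distribution P* on n states, every system of coefficients q_{ij} ≥ 0 (i ≠ j) with Σ_{j≠i} q_{ij} p*_j = (Σ_{j≠i} q_{ji}) p*_i for all i, and every positive probability distribution P, the entropy production is nonpositive: Σ_{i≠j} q_{ij} p*_j [ h(p_i/p*_i) − h(p_j/p*_j) + h'(p_i/p*_i)(p_j/p*_j − p_i/p*_i) ] ≤ 0. Then h is convex on (0,∞). -/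
open Finset

/-- Nonpositive entropy production along a single reversible pair of states, with a third,
isolated state absorbing the remaining mass, forces `deriv h` to be monotone. -/
theorem monotoneOn_deriv_of_entropy_production_nonpos
    (h : ℝ → ℝ)
    (hprod : ∀ n : ℕ, 3 ≤ n →
      ∀ pstar : Fin n → ℝ, (∀ i, 0 < pstar i) → ∑ i, pstar i = 1 →
      ∀ q : Fin n → Fin n → ℝ, (∀ i j, i ≠ j → 0 ≤ q i j) →
      (∀ i, ∑ j ∈ Finset.univ.erase i, q i j * pstar j
          = (∑ j ∈ Finset.univ.erase i, q j i) * pstar i) →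
      ∀ p : Fin n → ℝ, (∀ i, 0 < p i) → ∑ i, p i = 1 →
      ∑ i, ∑ j ∈ Finset.univ.erase i, q i j * pstar j *
        (h (p i / pstar i) - h (p j / pstar j)
          + deriv h (p i / pstar i) * (p j / pstar j - p i / pstar i)) ≤ 0) :
    MonotoneOn (deriv h) (Set.Ioi 0) := by
  intro x (hx : 0 < x) y (hy : 0 < y) hxy
  rcases hxy.eq_or_lt with rfl | hlt
  · exact le_rfl
  have e0 : (univ : Finset (Fin 3)).erase 0 = {1, 2} := by decide
  have e1 : (univ : Finset (Fin 3)).erase 1 = {0, 2} := by decide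
  have e2 : (univ : Finset (Fin 3)).erase 2 = {0, 1} := by decide
  have hs : 0 < 2 + x + y := by positivity
  have key := hprod 3 le_rfl
    ![1 / (2 + x + y), 1 / (2 + x + y), (x + y) / (2 + x + y)]
    (by intro i; fin_cases i <;> simp <;> positivity)
    (by simp [Fin.sum_univ_three]; field_simp; ring)
    ![![0, 1, 0], ![1, 0, 0], ![0, 0, 0]]
    (by intro i j _; fin_cases i <;> fin_cases j <;> simp)
    (by intro i; fin_cases i <;> simp [e0, e1, e2])
    ![x / (2 + x + y), y / (2 + x + y), 2 / (2 + x + y)]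
    (by intro i; fin_cases i <;> simp <;> positivity)
    (by simp [Fin.sum_univ_three]; field_simp; ring)
  have hdiv (t : ℝ) : t / (2 + x + y) / (1 / (2 + x + y)) = t := by field_simp
  simp only [Fin.sum_univ_three, e0, e1, e2, Finset.sum_pair (show (1 : Fin 3) ≠ 2 by decide),
    Finset.sum_pair (show (0 : Fin 3) ≠ 2 by decide),
    Finset.sum_pair (show (0 : Fin 3) ≠ 1 by decide), Matrix.cons_val, hdiv, zero_mul,
    add_zero, one_mul] at key
  rw [← mul_add] at key
  have hprod_le := nonpos_of_mul_nonpos_right key (by positivity)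
  nlinarith

/-- if the entropy production of `H_h` is nonpositive for every Markov chain
with every positive equilibrium (on every state space with at least 3 states) and every
positive probability distribution, then `h` is convex on `(0, ∞)`. -/
theorem convex_of_entropy_production_nonpos
    (h : ℝ → ℝ) (hdiff : ∀ x : ℝ, 0 < x → DifferentiableAt ℝ h x)
    (hprod : ∀ n : ℕ, 3 ≤ n →
      ∀ pstar : Fin n → ℝ, (∀ i, 0 < pstar i) → ∑ i, pstar i = 1 →
      ∀ q : Fin n → Fin n → ℝ, (∀ i j, i ≠ j → 0 ≤ q i j) →
      (∀ i, ∑ j ∈ Finset.univ.erase i, q i j * pstar j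
          = (∑ j ∈ Finset.univ.erase i, q j i) * pstar i) →
      ∀ p : Fin n → ℝ, (∀ i, 0 < p i) → ∑ i, p i = 1 →
      ∑ i, ∑ j ∈ Finset.univ.erase i, q i j * pstar j *
        (h (p i / pstar i) - h (p j / pstar j)
          + deriv h (p i / pstar i) * (p j / pstar j - p i / pstar i)) ≤ 0) :
    ConvexOn ℝ (Set.Ioi 0) h := by
  refine MonotoneOn.convexOn_of_deriv (convex_Ioi 0)
    (fun x hx => (hdiff x hx).continuousAt.continuousWithinAt) ?_ ?_
  · rw [interior_Ioi]
    exact fun x hx => (hdiff x hx).differentiableWithinAt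
  · rw [interior_Ioi]
    exact monotoneOn_deriv_of_entropy_production_nonpos h hprod
end

section
/- Let f : (0,1) × (0,1) → ℝ have a continuous partial derivative ∂f/∂p with respect to its first argument. Suppose that for every n ≥ 3, every positive probability distribution P* on n states, and every Markov chain with equilibrium P*, the trace-form function H(P) = Σ_i f(p_i, p*_i) is nonincreasing along every solution of the master equation with positive components. Then there exist a convex function h : (0,∞) → ℝ and a function c : (0,1) → ℝ such that f(p, p*) = p* · h(p/p*) + c(p*) for all p, p* ∈ (0,1). -/
open Finset

/-- The trace-form function `P ↦ ∑ i, f (p i) (p* i)` is nonincreasing along positive solutions of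
the master equation of every Markov chain on `n` states with positive equilibrium. -/
def IsTraceFormLyapunov (f : ℝ → ℝ → ℝ) (n : ℕ) : Prop :=
  ∀ pstar : Fin n → ℝ, (∀ i, 0 < pstar i) → ∑ i, pstar i = 1 →
  ∀ q : Fin n → Fin n → ℝ, (∀ i j, i ≠ j → 0 ≤ q i j) →
  (∀ i, ∑ j ∈ Finset.univ.erase i, q i j * pstar j
      = (∑ j ∈ Finset.univ.erase i, q j i) * pstar i) →
  ∀ T : ℝ, 0 ≤ T → ∀ p : ℝ → Fin n → ℝ,
  (∀ t ∈ Set.Icc (0:ℝ) T, (∀ i, 0 < p t i) ∧ ∑ i, p t i = 1) →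
  (∀ t ∈ Set.Icc (0:ℝ) T, ∀ i, HasDerivAt (fun s => p s i)
    (∑ j ∈ Finset.univ.erase i,
      q i j * pstar j * (p t j / pstar j - p t i / pstar i)) t) →
  AntitoneOn (fun t => ∑ i, f (p t i) (pstar i)) (Set.Icc (0:ℝ) T)

/-- Testing the Lyapunov property on a chain in which only two of the three states exchange mass. -/
lemma IsTraceFormLyapunov.deriv_sub_mul_nonpos {f : ℝ → ℝ → ℝ} (hf : IsTraceFormLyapunov f 3)
    {x y a b u v : ℝ} (hx : 0 < x) (hy : 0 < y) (hxy : x + y < 1)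
    (ha : 0 < a) (hb : 0 < b) (hab : a + b < 1)
    (hu : HasDerivAt (fun z => f z a) u x) (hv : HasDerivAt (fun z => f z b) v y) :
    (u - v) * (a * y - b * x) ≤ 0 := by
  have e0 : (univ.erase (0 : Fin 3)) = {1, 2} := by decide
  have e1 : (univ.erase (1 : Fin 3)) = {0, 2} := by decide
  have e2 : (univ.erase (2 : Fin 3)) = {0, 1} := by decide
  have habpos : 0 < a + b := by positivity
  set m : ℝ := a * (x + y) / (a + b) with hm
  set w : ℝ → ℝ := fun t => m + (x - m) * Real.exp (-(a + b) * t) with hw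
  have hmeq : m * (a + b) = a * (x + y) := by rw [hm]; field_simp
  have hm0 : 0 < m := by positivity
  have hm1 : m < x + y := by
    rw [hm, div_lt_iff₀ habpos]
    nlinarith [mul_pos hb (add_pos hx hy)]
  have hw0 : w 0 = x := by simp [hw]
  have hwd (t : ℝ) : HasDerivAt w (a * (x + y) - (a + b) * w t) t := by
    have h := ((((hasDerivAt_id t).const_mul (-(a + b))).exp).const_mul (x - m)).const_add m
    refine h.congr_deriv ?_
    simp only [hw, id]
    linear_combination hmeq
  have hwpos (t : ℝ) (ht : 0 ≤ t) : 0 < w t ∧ w t < x + y := by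
    have h1 : Real.exp (-(a + b) * t) ≤ 1 := Real.exp_le_one_iff.2 (by nlinarith)
    have h0 := Real.exp_pos (-(a + b) * t)
    simp only [hw]
    set e := Real.exp (-(a + b) * t)
    constructor <;> nlinarith [mul_pos hx h0, mul_pos hy h0,
      mul_nonneg hm0.le (sub_nonneg.2 h1), mul_nonneg (sub_pos.2 hm1).le (sub_nonneg.2 h1)]
  have key := hf ![a, b, 1 - a - b]
    (by intro i; fin_cases i <;> simp <;> linarith)
    (by simp [Fin.sum_univ_three])
    ![![0, a, 0], ![b, 0, 0], ![0, 0, 0]]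
    (by intro i j _; fin_cases i <;> fin_cases j <;> simp [ha.le, hb.le])
    (by intro i; fin_cases i <;> simp [e0, e1, e2] <;> ring)
    1 zero_le_one (fun t => ![w t, x + y - w t, 1 - x - y])
    (by
      intro t ht
      obtain ⟨h1, h2⟩ := hwpos t ht.1
      refine ⟨fun i => ?_, ?_⟩
      · fin_cases i <;> simp <;> linarith
      · simp [Fin.sum_univ_three])
    (by
      intro t _ i
      match i with
      | 0 =>
        rw [e0]
        refine (hwd t).congr_deriv ?_
        simp
        field_simp
        ring
      | 1 =>
        rw [e1]
        refine ((hwd t).const_sub (x + y)).congr_deriv ?_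
        simp
        field_simp
        ring
      | 2 =>
        rw [e2]
        refine (hasDerivAt_const t (1 - x - y)).congr_deriv ?_
        simp)
  have hd := hwd 0
  have hd' := hd.const_sub (x + y)
  have hF : HasDerivAt (fun t => f (w t) a + f (x + y - w t) b + f (1 - x - y) (1 - a - b))
      (u * (a * (x + y) - (a + b) * w 0) + v * -(a * (x + y) - (a + b) * w 0)) 0 := by
    refine HasDerivAt.add_const _ (HasDerivAt.add ?_ ?_)
    · exact HasDerivAt.comp (h₂ := fun z => f z a) 0 (by rwa [hw0]) hd
    · exact HasDerivAt.comp (h₂ := fun z => f z b) 0 (by rw [hw0]; simpa using hv) hd'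
  have hanti : AntitoneOn
      (fun t => f (w t) a + f (x + y - w t) b + f (1 - x - y) (1 - a - b)) (Set.Icc 0 1) := by
    simpa [Fin.sum_univ_three] using key
  have hle := hanti.derivWithin_nonpos (x := 0)
  rw [hF.hasDerivWithinAt.derivWithin
    (uniqueDiffOn_Icc zero_lt_one 0 (by simp)), hw0] at hle
  linarith

/-- The derivative of a trace-form Lyapunov function is monotone in the ratio `p / p*`. -/
lemma IsTraceFormLyapunov.deriv_le_deriv {f fp : ℝ → ℝ → ℝ} (hf : IsTraceFormLyapunov f 3)
    (hderiv : ∀ p ps : ℝ, p ∈ Set.Ioo (0:ℝ) 1 → ps ∈ Set.Ioo (0:ℝ) 1 →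
      HasDerivAt (fun x => f x ps) (fp p ps) p)
    (hcont : ContinuousOn (Function.uncurry fp) (Set.Ioo (0:ℝ) 1 ×ˢ Set.Ioo (0:ℝ) 1))
    {x y a b : ℝ} (hx : 0 < x) (hy : 0 < y) (hxy : x + y < 1)
    (ha : 0 < a) (hb : 0 < b) (hab : a + b < 1) (h : a * y ≤ b * x) :
    fp y b ≤ fp x a := by
  have hc : ContinuousAt (fun z => fp z a) x := by
    have h1 : ContinuousAt (Function.uncurry fp) (x, a) :=
      hcont.continuousAt ((isOpen_Ioo.prod isOpen_Ioo).mem_nhds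
        ⟨⟨hx, by linarith⟩, ⟨ha, by linarith⟩⟩)
    exact ContinuousAt.comp (f := fun z : ℝ => (z, a)) h1 (by fun_prop)
  refine ge_of_tendsto (hc.tendsto.mono_left (nhdsWithin_le_nhds (s := Set.Ioi x))) ?_
  filter_upwards [Ioo_mem_nhdsGT (show x < 1 - y by linarith)] with z hz
  have hlt : a * y - b * z < 0 := by nlinarith [mul_lt_mul_of_pos_left hz.1 hb]
  have hz0 : 0 < z := hx.trans hz.1
  have hprod := hf.deriv_sub_mul_nonpos hz0 hy (by linarith [hz.2]) ha hb hab
    (hderiv z a ⟨hz0, by linarith [hz.2]⟩ ⟨ha, by linarith⟩)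
    (hderiv y b ⟨hy, by linarith⟩ ⟨hb, by linarith⟩)
  by_contra hcon
  nlinarith [mul_pos_of_neg_of_neg (sub_neg.2 (not_le.1 hcon)) hlt]

/-- a universal trace-form Lyapunov function for Markov chains is a
Csiszár–Morimoto function: `f(p, p*) = p* h(p/p*) + c(p*)` with `h` convex. -/
theorem universal_trace_form_lyapunov
    (f : ℝ → ℝ → ℝ) (fp : ℝ → ℝ → ℝ)
    (hderiv : ∀ p ps : ℝ, p ∈ Set.Ioo (0:ℝ) 1 → ps ∈ Set.Ioo (0:ℝ) 1 →
      HasDerivAt (fun x => f x ps) (fp p ps) p)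
    (hcont : ContinuousOn (Function.uncurry fp) (Set.Ioo (0:ℝ) 1 ×ˢ Set.Ioo (0:ℝ) 1))
    (hlyap : ∀ n : ℕ, 3 ≤ n →
      ∀ pstar : Fin n → ℝ, (∀ i, 0 < pstar i) → ∑ i, pstar i = 1 →
      ∀ q : Fin n → Fin n → ℝ, (∀ i j, i ≠ j → 0 ≤ q i j) →
      (∀ i, ∑ j ∈ Finset.univ.erase i, q i j * pstar j
          = (∑ j ∈ Finset.univ.erase i, q j i) * pstar i) →
      ∀ T : ℝ, 0 ≤ T → ∀ p : ℝ → Fin n → ℝ,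
      (∀ t ∈ Set.Icc (0:ℝ) T, (∀ i, 0 < p t i) ∧ ∑ i, p t i = 1) →
      (∀ t ∈ Set.Icc (0:ℝ) T, ∀ i, HasDerivAt (fun s => p s i)
        (∑ j ∈ Finset.univ.erase i,
          q i j * pstar j * (p t j / pstar j - p t i / pstar i)) t) →
      AntitoneOn (fun t => ∑ i, f (p t i) (pstar i)) (Set.Icc (0:ℝ) T)) :
    ∃ h : ℝ → ℝ, ConvexOn ℝ (Set.Ioi 0) h ∧ ∃ c : ℝ → ℝ,
      ∀ p ps : ℝ, p ∈ Set.Ioo (0:ℝ) 1 → ps ∈ Set.Ioo (0:ℝ) 1 →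
        f p ps = ps * h (p / ps) + c ps := by
  have hf : IsTraceFormLyapunov f 3 := hlyap 3 le_rfl
  have hmono {x y a b : ℝ} := hf.deriv_le_deriv hderiv hcont (x := x) (y := y) (a := a) (b := b)
  set P : ℝ → ℝ := fun r => r / (2 * (1 + r)) with hP
  set A : ℝ → ℝ := fun r => 1 / (2 * (1 + r)) with hA
  have hP0 {r : ℝ} (hr : 0 < r) : 0 < P r := by positivity
  have hA0 {r : ℝ} (hr : 0 < r) : 0 < A r := by positivity
  have hP1 {r : ℝ} (hr : 0 < r) : P r < 1 / 2 := by
    simp only [hP]; rw [div_lt_div_iff₀ (by positivity) (by positivity)]; linarith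
  have hA1 {r : ℝ} (hr : 0 < r) : A r < 1 / 2 := by
    simp only [hA]; rw [div_lt_div_iff₀ (by positivity) (by positivity)]; linarith
  have hPA (r : ℝ) : P r = r * A r := by simp only [hP, hA]; ring
  set g : ℝ → ℝ := fun r => fp (P r) (A r)
  have hgmono : MonotoneOn g (Set.Ioi 0) := by
    intro r (hr : 0 < r) s (hs : 0 < s) hrs
    refine hmono (hP0 hs) (hP0 hr) (by linarith [hP1 hs, hP1 hr]) (hA0 hs) (hA0 hr)
      (by linarith [hA1 hs, hA1 hr]) ?_
    rw [hPA, hPA]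
    nlinarith [mul_le_mul_of_nonneg_left hrs (mul_pos (hA0 hr) (hA0 hs)).le]
  have hgcont : ContinuousOn g (Set.Ioi 0) := by
    have hPAc : ContinuousOn (fun r => (P r, A r)) (Set.Ioi 0) := by
      have hne : ∀ r ∈ Set.Ioi (0:ℝ), 2 * (1 + r) ≠ 0 := fun r (hr : 0 < r) => by positivity
      exact (ContinuousOn.div (by fun_prop) (by fun_prop) hne).prodMk
        (ContinuousOn.div (by fun_prop) (by fun_prop) hne)
    exact hcont.comp hPAc fun r (hr : 0 < r) =>
      ⟨⟨hP0 hr, by linarith [hP1 hr]⟩, ⟨hA0 hr, by linarith [hA1 hr]⟩⟩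
  have hfpg {p a : ℝ} (hp : p ∈ Set.Ioo (0:ℝ) 1) (ha : a ∈ Set.Ioo (0:ℝ) 1) :
      fp p a = g (p / a) := by
    obtain ⟨hp0, hp1⟩ := hp
    obtain ⟨ha0, ha1⟩ := ha
    have hr : 0 < p / a := div_pos hp0 ha0
    set t : ℝ := (1 - p) * (1 - a) with ht
    have ht0 : 0 < t := mul_pos (by linarith) (by linarith)
    have htp : t * p < 1 - p := by
      nlinarith [mul_pos (sub_pos.2 hp1) ha0, mul_pos (sub_pos.2 hp1) (sub_pos.2 ha1)]
    have hta : t * a < 1 - a := by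
      nlinarith [mul_pos (sub_pos.2 ha1) hp0, mul_pos (sub_pos.2 hp1) (sub_pos.2 ha1)]
    have htp' : t * p < 1 / 2 := by
      nlinarith [mul_pos (mul_pos hp0 (sub_pos.2 hp1)) ha0, sq_nonneg (p - 1 / 2)]
    have hta' : t * a < 1 / 2 := by
      nlinarith [mul_pos (mul_pos ha0 (sub_pos.2 ha1)) hp0, sq_nonneg (a - 1 / 2)]
    have hsmall : fp p a = fp (t * p) (t * a) := by
      apply le_antisymm
      · exact hmono (by positivity) hp0 (by linarith) (by positivity) ha0 (by linarith)
          (le_of_eq (by ring))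
      · exact hmono hp0 (by positivity) (by linarith) ha0 (by positivity) (by linarith)
          (le_of_eq (by ring))
    have hcross : t * a * P (p / a) = A (p / a) * (t * p) := by
      rw [hPA]; field_simp
    rw [hsmall]
    apply le_antisymm
    · exact hmono (hP0 hr) (by positivity) (by linarith [hP1 hr]) (hA0 hr) (by positivity)
        (by linarith [hA1 hr]) hcross.ge
    · exact hmono (by positivity) (hP0 hr) (by linarith [hP1 hr]) (by positivity) (hA0 hr)
        (by linarith [hA1 hr]) hcross.le
  set h : ℝ → ℝ := fun r => ∫ s in (1:ℝ)..r, g s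
  have hhd {r : ℝ} (hr : 0 < r) : HasDerivAt h (g r) r := by
    refine intervalIntegral.integral_hasDerivAt_right
      (ContinuousOn.intervalIntegrable (hgcont.mono ?_))
      (hgcont.stronglyMeasurableAtFilter isOpen_Ioi r hr)
      (hgcont.continuousAt (Ioi_mem_nhds hr))
    intro s hs
    exact (lt_min one_pos hr).trans_le hs.1
  refine ⟨h, ?_, fun a => f (1 / 2) a - a * h (1 / 2 / a), fun p a hp ha => ?_⟩
  · refine MonotoneOn.convexOn_of_deriv (convex_Ioi 0)
      (fun r hr => (hhd hr).continuousAt.continuousWithinAt) ?_ ?_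
    · rw [interior_Ioi]
      exact fun r hr => (hhd hr).differentiableAt.differentiableWithinAt
    · rw [interior_Ioi]
      exact hgmono.congr fun r hr => (hhd hr).deriv.symm
  · have hd (x : ℝ) (hx : x ∈ Set.Ioo (0:ℝ) 1) :
        HasDerivAt (fun x => f x a - a * h (x / a)) 0 x := by
      have hcomp := (HasDerivAt.comp (h₂ := h) (h := fun y => y / a) x (hhd (div_pos hx.1 ha.1))
        ((hasDerivAt_id x).div_const a)).const_mul a
      refine ((hderiv x a hx ha).sub hcomp).congr_deriv ?_
      rw [hfpg hx ha]
      have := ha.1.ne'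
      field_simp
      ring
    have hconst := isOpen_Ioo.is_const_of_deriv_eq_zero isPreconnected_Ioo
      (fun x hx => (hd x hx).differentiableAt.differentiableWithinAt)
      (fun x hx => (hd x hx).deriv) hp (show (1 / 2 : ℝ) ∈ Set.Ioo (0:ℝ) 1 by norm_num)
    linarith
end

section
/- The squared Euclidean distance B(P‖P*) = Σ_i (p_i − p*_i)² is not a universal Lyapunov function for Markov chains: there exist n ≥ 2, a positive probability distribution P* on n states, a positive probability distribution P⁰, and coefficients q_{ij} ≥ 0 (i ≠ j) with Σ_{j≠i} q_{ij} p*_j = (Σ_{j≠i} q_{ji}) p*_i for all i, such that the time derivative of Σ_i (p_i − p*_i)² along the master equation, evaluated at P⁰, is strictly positive. -/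
open Finset

/-- the squared Euclidean distance is not a universal Lyapunov function for
Markov chains: its time derivative along the master equation can be strictly positive. -/
theorem squared_euclidean_not_universal_lyapunov :
    ∃ n : ℕ, 2 ≤ n ∧
    ∃ (pstar P0 : Fin n → ℝ) (q : Fin n → Fin n → ℝ),
      (∀ i, 0 < pstar i) ∧ (∑ i, pstar i = 1) ∧
      (∀ i, 0 < P0 i) ∧ (∑ i, P0 i = 1) ∧
      (∀ i j, i ≠ j → 0 ≤ q i j) ∧
      (∀ i, ∑ j ∈ Finset.univ.erase i, q i j * pstar j
          = (∑ j ∈ Finset.univ.erase i, q j i) * pstar i) ∧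
      0 < ∑ i, 2 * (P0 i - pstar i) *
            (∑ j ∈ Finset.univ.erase i,
              q i j * pstar j * (P0 j / pstar j - P0 i / pstar i)) := by
  have h0 (f : Fin 3 → ℝ) : ∑ j ∈ univ.erase 0, f j = f 1 + f 2 := by
    rw [show (univ : Finset (Fin 3)).erase 0 = {1, 2} by decide, sum_pair (by decide)]
  have h1 (f : Fin 3 → ℝ) : ∑ j ∈ univ.erase 1, f j = f 0 + f 2 := by
    rw [show (univ : Finset (Fin 3)).erase 1 = {0, 2} by decide, sum_pair (by decide)]
  have h2 (f : Fin 3 → ℝ) : ∑ j ∈ univ.erase 2, f j = f 0 + f 1 := by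
    rw [show (univ : Finset (Fin 3)).erase 2 = {0, 1} by decide, sum_pair (by decide)]
  refine ⟨3, by norm_num, ![1/2, 1/8, 3/8], ![5/8, 3/16, 3/16],
    ![![0, 4, 0], ![1, 0, 0], ![0, 0, 0]], ?_, ?_, ?_, ?_, ?_, ?_, ?_⟩
  · intro i; fin_cases i <;> norm_num
  · simp only [Fin.sum_univ_three, Matrix.cons_val]
    norm_num
  · intro i; fin_cases i <;> norm_num
  · simp only [Fin.sum_univ_three, Matrix.cons_val]
    norm_num
  · intro i j _; fin_cases i <;> fin_cases j <;> norm_num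
  · rw [Fin.forall_fin_succ, Fin.forall_fin_two]
    simp only [Fin.succ_zero_eq_one, Fin.succ_one_eq_two, h0, h1, h2, Matrix.cons_val]
    norm_num
  · simp only [Fin.sum_univ_three, h0, h1, h2, Matrix.cons_val]
    norm_num
end

section
/- The Itakura–Saito divergence B(P‖P*) = Σ_i ( p_i/p*_i − ln(p_i/p*_i) − 1 ) is not a universal Lyapunov function for Markov chains: there exist n ≥ 2, a positive probability distribution P* on n states, a positive probability distribution P⁰, and coefficients q_{ij} ≥ 0 (i ≠ j) with Σ_{j≠i} q_{ij} p*_j = (Σ_{j≠i} q_{ji}) p*_i for all i, such that the time derivative of B(P‖P*) along the master equation, evaluated at P⁰, is strictly positive. -/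
open Finset

/-- the Itakura–Saito divergence `∑ (pᵢ/p*ᵢ − ln(pᵢ/p*ᵢ) − 1)` is not a
universal Lyapunov function for Markov chains: its time derivative along the master
equation can be strictly positive. -/
theorem itakura_saito_not_universal_lyapunov :
    ∃ n : ℕ, 2 ≤ n ∧
    ∃ (pstar P0 : Fin n → ℝ) (q : Fin n → Fin n → ℝ),
      (∀ i, 0 < pstar i) ∧ (∑ i, pstar i = 1) ∧
      (∀ i, 0 < P0 i) ∧ (∑ i, P0 i = 1) ∧
      (∀ i j, i ≠ j → 0 ≤ q i j) ∧
      (∀ i, ∑ j ∈ Finset.univ.erase i, q i j * pstar j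
          = (∑ j ∈ Finset.univ.erase i, q j i) * pstar i) ∧
      0 < ∑ i, (1 / pstar i - 1 / P0 i) *
            (∑ j ∈ Finset.univ.erase i,
              q i j * pstar j * (P0 j / pstar j - P0 i / pstar i)) := by
  have h0 (f : Fin 3 → ℝ) : ∑ j ∈ univ.erase 0, f j = f 1 + f 2 := by
    rw [show (univ : Finset (Fin 3)).erase 0 = {1, 2} by decide, sum_pair (by decide)]
  have h1 (f : Fin 3 → ℝ) : ∑ j ∈ univ.erase 1, f j = f 0 + f 2 := by
    rw [show (univ : Finset (Fin 3)).erase 1 = {0, 2} by decide, sum_pair (by decide)]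
  have h2 (f : Fin 3 → ℝ) : ∑ j ∈ univ.erase 2, f j = f 0 + f 1 := by
    rw [show (univ : Finset (Fin 3)).erase 2 = {0, 1} by decide, sum_pair (by decide)]
  refine ⟨3, by norm_num, ![1 / 25, 4 / 25, 20 / 25], ![2 / 25, 16 / 25, 7 / 25],
    ![![0, 1, 0], ![4, 0, 0], ![0, 0, 0]], ?_, ?_, ?_, ?_, ?_, ?_, ?_⟩
  · intro i; fin_cases i <;> norm_num
  · simp only [Fin.sum_univ_three, Matrix.cons_val]; norm_num
  · intro i; fin_cases i <;> norm_num
  · simp only [Fin.sum_univ_three, Matrix.cons_val]; norm_num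
  · intro i j _; fin_cases i <;> fin_cases j <;> norm_num
  · intro i
    fin_cases i <;>
      simp only [Fin.zero_eta, Fin.mk_one, Fin.reduceFinMk, h0, h1, h2, Matrix.cons_val] <;>
      norm_num
  · simp only [Fin.sum_univ_three, h0, h1, h2, Matrix.cons_val]
    norm_num
end

section
/- For any positive probability distributions P and P* on n states, the local order cone Q_{(P,P*)} is a proper cone: if a vector v satisfies both v ∈ Q_{(P,P*)} and −v ∈ Q_{(P,P*)}, then v = 0. In particular Q_{(P,P*)} contains no straight line. -/
open Finset

/-- The local order cone `Q_{(P,P*)}`: all possible time derivatives of the probability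
distribution at `p` for Markov processes with equilibrium `pstar`. -/
def localCone (n : ℕ) (p pstar : Fin n → ℝ) : Set (Fin n → ℝ) :=
  {v | ∃ q : Fin n → Fin n → ℝ,
    (∀ i j, i ≠ j → 0 ≤ q i j) ∧
    (∀ i, ∑ j ∈ Finset.univ.erase i, q i j * pstar j
        = (∑ j ∈ Finset.univ.erase i, q j i) * pstar i) ∧
    (∀ i, v i = ∑ j ∈ Finset.univ.erase i,
        q i j * pstar j * (p j / pstar j - p i / pstar i))}

/-- A vector of the local order cone is given by a nonnegative balanced flow `w`. -/
theorem exists_balanced_flow_of_mem_localCone {n : ℕ} {p pstar v : Fin n → ℝ}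
    (hps : ∀ i, 0 < pstar i) (hv : v ∈ localCone n p pstar) :
    ∃ w : Fin n → Fin n → ℝ, (∀ i j, 0 ≤ w i j) ∧
      (∀ i, ∑ j, w i j = ∑ j, w j i) ∧
      ∀ i, v i = ∑ j, w i j * (p j / pstar j - p i / pstar i) := by
  obtain ⟨q, hq, hbal, hv⟩ := hv
  refine ⟨fun i j => if i = j then 0 else q i j * pstar j, fun i j => ?_, fun i => ?_,
    fun i => ?_⟩
  · dsimp only
    split_ifs with h
    · exact le_rfl
    · exact mul_nonneg (hq i j h) (hps j).le
  · have h := hbal i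
    rw [Finset.sum_mul] at h
    rw [← Finset.add_sum_erase _ _ (Finset.mem_univ i),
      ← Finset.add_sum_erase _ _ (Finset.mem_univ i)]
    simp only [if_true, zero_add]
    convert h using 1
    · exact Finset.sum_congr rfl fun j hj => if_neg (Finset.ne_of_mem_erase hj).symm
    · exact Finset.sum_congr rfl fun j hj => if_neg (Finset.ne_of_mem_erase hj)
  · rw [hv i, ← Finset.add_sum_erase _ _ (Finset.mem_univ i)]
    simp only [if_true, zero_mul, zero_add]
    exact Finset.sum_congr rfl fun j hj => by rw [if_neg (Finset.ne_of_mem_erase hj).symm]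

/-- The dissipation identity for a balanced flow. -/
theorem two_mul_sum_mul_flow_eq {ι : Type*} [Fintype ι] {w : ι → ι → ℝ}
    (hbal : ∀ i, ∑ j, w i j = ∑ j, w j i) (x : ι → ℝ) :
    2 * ∑ i, x i * ∑ j, w i j * (x j - x i) = -∑ i, ∑ j, w i j * (x j - x i) ^ 2 := by
  have key : ∑ i, ∑ j, w i j * x i ^ 2 = ∑ i, ∑ j, w i j * x j ^ 2 := by
    rw [Finset.sum_comm (f := fun i j => w i j * x j ^ 2)]
    exact Finset.sum_congr rfl fun i _ => by rw [← Finset.sum_mul, hbal i, Finset.sum_mul]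
  have expand : 2 * ∑ i, x i * ∑ j, w i j * (x j - x i) + ∑ i, ∑ j, w i j * (x j - x i) ^ 2
      = ∑ i, ∑ j, w i j * x j ^ 2 - ∑ i, ∑ j, w i j * x i ^ 2 := by
    simp only [Finset.mul_sum, ← Finset.sum_add_distrib, ← Finset.sum_sub_distrib]
    exact Finset.sum_congr rfl fun i _ => Finset.sum_congr rfl fun j _ => by ring
  linarith

/-- A balanced flow without dissipation has zero velocity. -/
theorem flow_eq_zero_of_dissipation_nonpos {ι : Type*} [Fintype ι] {w : ι → ι → ℝ}
    (hw : ∀ i j, 0 ≤ w i j) {x : ι → ℝ}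
    (h : ∑ i, ∑ j, w i j * (x j - x i) ^ 2 ≤ 0) (i : ι) :
    ∑ j, w i j * (x j - x i) = 0 := by
  have nonneg : ∀ i j, 0 ≤ w i j * (x j - x i) ^ 2 := fun i j =>
    mul_nonneg (hw i j) (sq_nonneg _)
  have rows := (Finset.sum_eq_zero_iff_of_nonneg fun i _ =>
    Finset.sum_nonneg fun j _ => nonneg i j).1
    (h.antisymm (Finset.sum_nonneg fun i _ => Finset.sum_nonneg fun j _ => nonneg i j))
  refine Finset.sum_eq_zero fun j hj => ?_
  have entry := (Finset.sum_eq_zero_iff_of_nonneg fun j _ => nonneg i j).1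
    (rows i (Finset.mem_univ i)) j hj
  simpa using entry

/-- the local order cone is a proper cone: it contains no straight line. -/
theorem localCone_proper (n : ℕ) (p pstar : Fin n → ℝ)
    (hp : ∀ i, 0 < p i) (hp1 : ∑ i, p i = 1)
    (hps : ∀ i, 0 < pstar i) (hps1 : ∑ i, pstar i = 1)
    (v : Fin n → ℝ) (hv : v ∈ localCone n p pstar) (hv' : -v ∈ localCone n p pstar) :
    v = 0 := by
  obtain ⟨w, hw, hbal, hv⟩ := exists_balanced_flow_of_mem_localCone hps hv
  obtain ⟨w', hw', hbal', hv'⟩ := exists_balanced_flow_of_mem_localCone hps hv'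
  have h := two_mul_sum_mul_flow_eq hbal fun i => p i / pstar i
  have h' := two_mul_sum_mul_flow_eq hbal' fun i => p i / pstar i
  simp only [← hv] at h
  simp only [← hv', Pi.neg_apply, mul_neg, Finset.sum_neg_distrib] at h'
  have nonneg' : 0 ≤ ∑ i, ∑ j, w' i j * (p j / pstar j - p i / pstar i) ^ 2 :=
    Finset.sum_nonneg fun i _ => Finset.sum_nonneg fun j _ =>
      mul_nonneg (hw' i j) (sq_nonneg _)
  funext i
  rw [hv i]
  exact flow_eq_zero_of_dissipation_nonpos hw (x := fun i => p i / pstar i)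
    (by linarith) i
end

section
/- For any positive probability distributions P and P* on n states, the local order cone Q_{(P,P*)} equals the conic hull (the set of all nonnegative linear combinations) of the vectors γ^{ij} · sgn( p_i/p*_i − p_j/p*_j ) taken over all pairs i < j, where γ^{ij} ∈ ℝ^n has coordinates γ^{ij}_k = δ_{jk} − δ_{ik} and sgn is the three-valued sign function. Consequently, the cone of possible time derivatives of all Markov chains with equilibrium P* coincides with the cone generated by reversible two-state transitions A_i ⇄ A_j satisfying detailed balance, with a directing extreme-ray choice of intensities q_{ij} = 1/p*_j, q_{ji} = 1/p*_i. -/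
open Finset

/-- The vector `γ^{ij}` with `i`-th coordinate `−1`, `j`-th coordinate `+1`, zero elsewhere. -/
def gammaVec (n : ℕ) (i j : Fin n) : Fin n → ℝ :=
  fun k => (if k = j then (1:ℝ) else 0) - (if k = i then (1:ℝ) else 0)

/-- A finset `U` is a threshold set for `r` when some threshold separates the values of `r` on `U` from those
on its complement. -/
def IsThresholdSet {ι : Type*} (r : ι → ℝ) (U : Finset ι) : Prop :=
  ∃ t, (∀ i ∈ U, t ≤ r i) ∧ ∀ i ∉ U, r i ≤ t

/-- A vector with zero total mass whose mass on every threshold set is nonpositive is a sum of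
transfers of mass from larger to strictly smaller values of `r`. -/
theorem mem_of_sum_thresholdSet_nonpos {ι : Type*} [Fintype ι] [DecidableEq ι] {r : ι → ℝ}
    {M : AddSubmonoid (ι → ℝ)}
    (hM : ∀ i j (c : ℝ), 0 ≤ c → r j < r i → Pi.single j c - Pi.single i c ∈ M)
    (v : ι → ℝ) (hv : ∑ i, v i = 0)
    (hU : ∀ U : Finset ι, IsThresholdSet r U → ∑ i ∈ U, v i ≤ 0) : v ∈ M := by
  induction hk : #{i | v i ≠ 0} using Nat.strong_induction_on generalizing v with
  | _ k ih =>
  by_cases h0 : v = 0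
  · exact h0 ▸ M.zero_mem
  obtain ⟨b₀, hb₀⟩ : ∃ b, 0 < v b := by
    by_contra! h
    exact h0 (funext fun i => (Finset.sum_eq_zero_iff_of_nonpos fun i _ => h i).1 hv i
      (Finset.mem_univ i))
  obtain ⟨b, hb, hmax⟩ := Finset.exists_max_image ({i | 0 < v i} : Finset ι) r ⟨b₀, by simpa⟩
  have hb : 0 < v b := by simpa using hb
  have hmax : ∀ i, r b < r i → v i ≤ 0 := fun i hi => by
    by_contra! h
    exact (hmax i (by simpa using h)).not_gt hi
  obtain ⟨a, hab, ha⟩ : ∃ a, r b < r a ∧ v a < 0 := by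
    by_contra! h
    have hle := hU (insert b ({i | r b < r i} : Finset ι)) ⟨r b, by
      simp +contextual [le_of_lt], by simp +contextual⟩
    rw [Finset.sum_insert (by simp)] at hle
    have : 0 ≤ ∑ i ∈ ({i | r b < r i} : Finset ι), v i :=
      Finset.sum_nonneg fun i hi => h i (by simpa using hi)
    linarith
  have hne : a ≠ b := by rintro rfl; exact hab.false
  set ε := min (v b) (-v a) with hε
  have hε0 : 0 < ε := lt_min hb (by linarith)
  have hεb : ε ≤ v b := min_le_left _ _
  have hεa : ε ≤ -v a := min_le_right _ _
  set u : ι → ℝ := Pi.single b ε - Pi.single a ε with hu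
  have hsum : ∀ U : Finset ι, ∑ i ∈ U, (v - u) i
      = ∑ i ∈ U, v i - (if b ∈ U then ε else 0) + (if a ∈ U then ε else 0) := fun U => by
    simp only [hu, Pi.sub_apply, Finset.sum_sub_distrib, Finset.sum_pi_single']
    ring
  have hmem : v - u ∈ M := by
    refine ih _ ?_ (v - u) ?_ ?_ rfl
    · rw [← hk]
      have hsub : ({i | (v - u) i ≠ 0} : Finset ι) ⊆ ({i | v i ≠ 0} : Finset ι) := by
        intro i
        simp only [Finset.mem_filter, Finset.mem_univ, true_and]
        contrapose!
        intro hi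
        have hia : i ≠ a := by rintro rfl; linarith
        have hib : i ≠ b := by rintro rfl; linarith
        simp [hu, hi, hia, hib]
      refine Finset.card_lt_card (Finset.ssubset_iff_subset_ne.2 ⟨hsub, fun heq => ?_⟩)
      have hma : (v - u) a ≠ 0 := by
        have : a ∈ ({i | v i ≠ 0} : Finset ι) := by simpa using ha.ne
        rw [← heq] at this
        simpa using this
      have hmb : (v - u) b ≠ 0 := by
        have : b ∈ ({i | v i ≠ 0} : Finset ι) := by simpa using hb.ne'
        rw [← heq] at this
        simpa using this
      simp only [hu, Pi.sub_apply, Pi.single_eq_same, Pi.single_eq_of_ne hne,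
        Pi.single_eq_of_ne hne.symm] at hma hmb
      rcases min_choice (v b) (-v a) with h | h
      · exact hmb (by rw [hε, h]; ring)
      · exact hma (by rw [hε, h]; ring)
    · rw [hsum, hv]
      simp
    · intro U hUt
      have hle := hU U hUt
      rw [hsum]
      by_cases hbU : b ∈ U
      · split_ifs <;> linarith
      by_cases haU : a ∈ U
      swap
      · simpa [hbU, haU] using hle
      simp only [hbU, haU, if_true, if_false]
      obtain ⟨t, ht, ht'⟩ := hUt
      rcases (ht' b hbU).eq_or_lt with hbt | hbt
      · have := hU (insert b U) ⟨t, by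
          simpa [hbt] using ht, fun i hi => ht' i (by simp_all)⟩
        rw [Finset.sum_insert hbU] at this
        linarith
      · have := Finset.sum_le_sum_of_subset_of_nonneg (f := fun i => -v i)
          (Finset.singleton_subset_iff.2 haU)
          fun i hi _ => neg_nonneg.2 (hmax i (hbt.trans_le (ht i hi)))
        simp only [Finset.sum_singleton, Finset.sum_neg_distrib] at this
        linarith
  have := M.add_mem hmem (hM a b ε hε0.le hab)
  rwa [← hu, sub_add_cancel] at this

/-- A circulation transports no net amount of any potential. -/
theorem sum_circulation_mul_sub {ι : Type*} [Fintype ι] {w : ι → ι → ℝ}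
    (hw : ∀ i, ∑ j, w i j = ∑ j, w j i) (g : ι → ℝ) :
    ∑ i, ∑ j, w i j * (g j - g i) = 0 := by
  simp only [mul_sub, Finset.sum_sub_distrib]
  rw [Finset.sum_comm]
  simp only [← Finset.sum_mul, hw, sub_self]

theorem sum_thresholdSet_circulation_nonpos {ι : Type*} [Fintype ι] {w : ι → ι → ℝ}
    (hw0 : ∀ i j, 0 ≤ w i j) (hw : ∀ i, ∑ j, w i j = ∑ j, w j i) {r : ι → ℝ} {U : Finset ι}
    (hU : IsThresholdSet r U) : ∑ i ∈ U, ∑ j, w i j * (r j - r i) ≤ 0 := by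
  classical
  obtain ⟨t, ht, ht'⟩ := hU
  have hg := sum_circulation_mul_sub hw fun i => if i ∈ U then r i - t else 0
  rw [← Finset.sum_filter_add_sum_filter_not Finset.univ (· ∈ U)] at hg
  rw [← Finset.filter_univ_mem U]
  have hin : ∑ i with i ∈ U, ∑ j, w i j * (r j - r i) ≤ ∑ i with i ∈ U, ∑ j,
      w i j * ((if j ∈ U then r j - t else 0) - if i ∈ U then r i - t else 0) := by
    refine Finset.sum_le_sum fun i hi => Finset.sum_le_sum fun j _ =>
      mul_le_mul_of_nonneg_left ?_ (hw0 i j)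
    have hi : i ∈ U := by simpa using hi
    by_cases hj : j ∈ U
    · simp [hi, hj]
    · have := ht' j hj
      simp only [hi, hj, if_true, if_false]
      linarith
  have hout : 0 ≤ ∑ i with i ∉ U, ∑ j,
      w i j * ((if j ∈ U then r j - t else 0) - if i ∈ U then r i - t else 0) := by
    refine Finset.sum_nonneg fun i hi => Finset.sum_nonneg fun j _ => mul_nonneg (hw0 i j) ?_
    have hi : i ∉ U := by simpa using hi
    by_cases hj : j ∈ U
    · simpa [hi, hj] using ht j hj
    · simp [hi, hj]
  linarith

/-- The conic hull of the directed two-state vectors, as an additive submonoid. -/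
def twoStateCone (n : ℕ) (r : Fin n → ℝ) : AddSubmonoid (Fin n → ℝ) where
  carrier := {v | ∃ c : Fin n → Fin n → ℝ, (∀ i j, 0 ≤ c i j) ∧
    v = ∑ i, ∑ j, if i < j then
      c i j • (Real.sign (r i - r j) • gammaVec n i j) else 0}
  zero_mem' := ⟨0, by simp, by simp⟩
  add_mem' := by
    rintro _ _ ⟨c, hc, rfl⟩ ⟨d, hd, rfl⟩
    refine ⟨c + d, fun i j => add_nonneg (hc i j) (hd i j), ?_⟩
    simp only [← Finset.sum_add_distrib, Pi.add_apply, add_smul]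
    refine Finset.sum_congr rfl fun i _ => Finset.sum_congr rfl fun j _ => ?_
    split_ifs <;> simp

theorem smul_sign_smul_gammaVec_mem_twoStateCone {n : ℕ} (r : Fin n → ℝ) {i j : Fin n}
    (hij : i < j) {c : ℝ} (hc : 0 ≤ c) :
    c • (Real.sign (r i - r j) • gammaVec n i j) ∈ twoStateCone n r := by
  refine ⟨fun k l => if k = i ∧ l = j then c else 0, fun k l => by positivity, ?_⟩
  rw [Finset.sum_eq_single i, Finset.sum_eq_single j]
  · simp [hij]
  · intro l _ hl
    simp [hl]
  · simp
  · intro k _ hk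
    simp [hk]
  · simp

theorem single_sub_single_mem_twoStateCone {n : ℕ} (r : Fin n → ℝ) (i j : Fin n) (c : ℝ)
    (hc : 0 ≤ c) (hr : r j < r i) : Pi.single j c - Pi.single i c ∈ twoStateCone n r := by
  have hne : i ≠ j := by rintro rfl; exact hr.false
  rcases hne.lt_or_gt with h | h
  · convert smul_sign_smul_gammaVec_mem_twoStateCone r h hc using 1
    ext k
    simp [Real.sign_of_pos (sub_pos.2 hr), gammaVec, Pi.single_apply, mul_sub]
  · convert smul_sign_smul_gammaVec_mem_twoStateCone r h hc using 1
    ext k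
    simp [Real.sign_of_neg (sub_neg.2 hr), gammaVec, Pi.single_apply, mul_sub]

/-- the local order cone equals the conic hull of the vectors
`sgn(pᵢ/p*ᵢ − pⱼ/p*ⱼ) · γ^{ij}` over all pairs `i < j`; i.e., the cone of possible time
derivatives of Markov chains with equilibrium `pstar` is generated by reversible two-state
transitions satisfying detailed balance. -/
theorem localCone_eq_conicHull_of_two_state_cycles
    (n : ℕ) (p pstar : Fin n → ℝ)
    (hp : ∀ i, 0 < p i) (hp1 : ∑ i, p i = 1)
    (hps : ∀ i, 0 < pstar i) (hps1 : ∑ i, pstar i = 1) :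
    localCone n p pstar =
      {v | ∃ c : Fin n → Fin n → ℝ, (∀ i j, 0 ≤ c i j) ∧
        v = ∑ i, ∑ j, if i < j then
              c i j • (Real.sign (p i / pstar i - p j / pstar j) • gammaVec n i j)
            else 0} := by
  set r : Fin n → ℝ := fun i => p i / pstar i with hr
  change localCone n p pstar = (twoStateCone n r : Set (Fin n → ℝ))
  refine Set.Subset.antisymm ?_ ?_
  · rintro v ⟨q, hq, hbal, hv⟩
    set w : Fin n → Fin n → ℝ := fun i j => if i = j then 0 else q i j * pstar j with hw
    have hw0 : ∀ i j, 0 ≤ w i j := fun i j => by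
      simp only [hw]
      split_ifs with h
      · exact le_rfl
      · exact mul_nonneg (hq i j h) (hps j).le
    have herase : ∀ i (f : Fin n → ℝ), f i = 0 → ∑ j, f j = ∑ j ∈ Finset.univ.erase i, f j :=
      fun i f hf => (Finset.sum_erase _ hf).symm
    have hcirc : ∀ i, ∑ j, w i j = ∑ j, w j i := fun i => by
      rw [herase i (fun j => w i j) (by simp [hw]), herase i (fun j => w j i) (by simp [hw])]
      refine Eq.trans (Eq.trans ?_ (hbal i)) ?_
      · refine Finset.sum_congr rfl fun j hj => ?_
        simp [hw, (Finset.ne_of_mem_erase hj).symm]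
      · rw [Finset.sum_mul]
        refine Finset.sum_congr rfl fun j hj => ?_
        simp [hw, Finset.ne_of_mem_erase hj]
    have hvw : ∀ i, v i = ∑ j, w i j * (r j - r i) := fun i => by
      rw [hv, herase i (fun j => w i j * (r j - r i)) (by simp)]
      refine Finset.sum_congr rfl fun j hj => ?_
      simp [hw, hr, (Finset.ne_of_mem_erase hj).symm]
    refine mem_of_sum_thresholdSet_nonpos (M := twoStateCone n r)
      (single_sub_single_mem_twoStateCone r) v ?_ fun U hU => ?_
    · simp only [hvw, sum_circulation_mul_sub hcirc]
    · simp only [hvw]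
      exact sum_thresholdSet_circulation_nonpos hw0 hcirc hU
  · rintro v ⟨c, hc, rfl⟩
    set d : Fin n → Fin n → ℝ := fun i j => c (min i j) (max i j) / |r i - r j| with hd
    have hd0 : ∀ i j, 0 ≤ d i j := fun i j => div_nonneg (hc _ _) (abs_nonneg _)
    have hsymm : ∀ i j, d i j = d j i := fun i j => by
      simp only [hd, min_comm, max_comm, abs_sub_comm]
    have hsign : ∀ x : ℝ, x / |x| = Real.sign x := fun x => by
      rcases lt_trichotomy x 0 with h | rfl | h
      · rw [abs_of_neg h, Real.sign_of_neg h, div_neg, div_self h.ne]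
      · simp
      · rw [abs_of_pos h, Real.sign_of_pos h, div_self h.ne']
    have hflux : ∀ i j, d i j / pstar j * pstar j = d i j := fun i j =>
      div_mul_cancel₀ _ (hps j).ne'
    refine ⟨fun i j => d i j / pstar j, fun i j _ => div_nonneg (hd0 i j) (hps j).le,
      fun i => ?_, fun k => ?_⟩
    · rw [Finset.sum_mul]
      simp only [hflux]
      exact Finset.sum_congr rfl fun j _ => hsymm i j
    · have hterm : ∀ l, d k l * (r l - r k)
          = (if l < k then c l k * Real.sign (r l - r k) else 0)
            - if k < l then c k l * Real.sign (r k - r l) else 0 := fun l => by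
        rcases lt_trichotomy l k with h | rfl | h
        · simp only [hd, h, h.not_gt, min_eq_right h.le, max_eq_left h.le, if_true, if_false,
            ← hsign, abs_sub_comm (r k)]
          ring
        · simp
        · simp only [hd, h, h.not_gt, min_eq_left h.le, max_eq_right h.le, if_true, if_false,
            ← hsign]
          ring
      have hsplit : ∀ i j, (if i < j then
            c i j • (Real.sign (r i - r j) • gammaVec n i j) else 0) k
          = (if k = j then if i < j then c i j * Real.sign (r i - r j) else 0 else 0)
            - if k = i then if i < j then c i j * Real.sign (r i - r j) else 0 else 0 :=
        fun i j => by
          by_cases h : i < j <;> simp [h, gammaVec, mul_sub]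
      simp only [hflux]
      change _ = ∑ j ∈ Finset.univ.erase k, d k j * (r j - r k)
      rw [Finset.sum_erase _ (by simp)]
      simp only [hterm, Finset.sum_apply, hsplit, Finset.sum_sub_distrib]
      congr 1
      · simp
      · rw [Finset.sum_comm]
        simp
end

section
/- Let P* be a positive probability distribution on n states and let P⁰, P¹ be probability distributions. Suppose there exists a continuous, piecewise continuously differentiable curve P : [0,1] → Σ_n in the simplex of probability distributions with P(0) = P⁰, P(1) = P¹, and dP(t)/dt ∈ Q_{(P(t),P*)} at every t where P is differentiable. Then P¹ − P⁰ ∈ Q_{(P⁰,P*)}; that is, if P⁰ precedes P¹ in the Markov order with equilibrium P*, then P¹ − P⁰ lies in the local order cone at P⁰. -/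
open Finset

/-- The local order cone in terms of equilibrium fluxes `w i j = q i j * pstar j`. -/
lemma mem_localCone_iff {n : ℕ} {p pstar v : Fin n → ℝ} (hps : ∀ i, 0 < pstar i) :
    v ∈ localCone n p pstar ↔ ∃ w : Fin n → Fin n → ℝ, (∀ i j, 0 ≤ w i j) ∧
      (∀ i, ∑ j, w i j = ∑ j, w j i) ∧
      ∀ i, v i = ∑ j, w i j * (p j / pstar j - p i / pstar i) := by
  constructor
  · rintro ⟨q, hq, hbal, hv⟩
    refine ⟨fun i j => if i = j then 0 else q i j * pstar j, fun i j => ?_, fun i => ?_,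
      fun i => ?_⟩
    · dsimp only
      split_ifs with h
      · exact le_rfl
      · exact mul_nonneg (hq i j h) (hps j).le
    · rw [← Finset.add_sum_erase _ _ (Finset.mem_univ i),
        ← Finset.add_sum_erase _ (fun j => if j = i then 0 else q j i * pstar i)
          (Finset.mem_univ i)]
      simp only [if_true]
      rw [Finset.sum_congr rfl fun j hj => if_neg (Finset.ne_of_mem_erase hj).symm,
        Finset.sum_congr rfl fun j hj => if_neg (Finset.ne_of_mem_erase hj), hbal i,
        Finset.sum_mul]
    · rw [← Finset.add_sum_erase _ _ (Finset.mem_univ i), hv i]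
      simp only [if_true, zero_mul, zero_add]
      refine Finset.sum_congr rfl fun j hj => ?_
      rw [if_neg (Finset.ne_of_mem_erase hj).symm]
  · rintro ⟨w, hw, hbal, hv⟩
    have hcancel : ∀ i j, w i j / pstar j * pstar j = w i j := fun i j =>
      div_mul_cancel₀ _ (hps j).ne'
    refine ⟨fun i j => w i j / pstar j, fun i j _ => div_nonneg (hw i j) (hps j).le,
      fun i => ?_, fun i => ?_⟩
    · have h := hbal i
      rw [← Finset.add_sum_erase _ _ (Finset.mem_univ i),
        ← Finset.add_sum_erase _ (fun j => w j i) (Finset.mem_univ i)] at h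
      simp only [hcancel, Finset.sum_mul]
      exact add_left_cancel h
    · rw [hv i, ← Finset.add_sum_erase _ _ (Finset.mem_univ i)]
      simp [hcancel]

lemma zero_mem_localCone {n : ℕ} {p pstar : Fin n → ℝ} (hps : ∀ i, 0 < pstar i) :
    (0 : Fin n → ℝ) ∈ localCone n p pstar :=
  (mem_localCone_iff hps).2 ⟨0, by simp, by simp, by simp⟩

lemma add_mem_localCone {n : ℕ} {p pstar u v : Fin n → ℝ} (hps : ∀ i, 0 < pstar i)
    (hu : u ∈ localCone n p pstar) (hv : v ∈ localCone n p pstar) :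
    u + v ∈ localCone n p pstar := by
  rw [mem_localCone_iff hps] at *
  obtain ⟨w, hw, hwb, hwu⟩ := hu
  obtain ⟨z, hz, hzb, hzv⟩ := hv
  refine ⟨w + z, fun i j => add_nonneg (hw i j) (hz i j), fun i => ?_, fun i => ?_⟩
  · simp only [Pi.add_apply, Finset.sum_add_distrib, hwb i, hzb i]
  · simp only [Pi.add_apply, add_mul, Finset.sum_add_distrib, hwu i, hzv i]

/-- Moving mass from a state to another one with strictly smaller density ratio is an admissible
direction. -/
lemma single_sub_single_mem_localCone {n : ℕ} {p pstar : Fin n → ℝ} (hps : ∀ i, 0 < pstar i)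
    {a b : Fin n} (hab : p b / pstar b < p a / pstar a) {c : ℝ} (hc : 0 ≤ c) :
    (Pi.single b c - Pi.single a c : Fin n → ℝ) ∈ localCone n p pstar := by
  have hne : a ≠ b := by rintro rfl; exact lt_irrefl _ hab
  have hd : 0 < p a / pstar a - p b / pstar b := sub_pos.2 hab
  rw [mem_localCone_iff hps]
  set k := c / (p a / pstar a - p b / pstar b) with hk
  have hkc : k * (p a / pstar a - p b / pstar b) = c := div_mul_cancel₀ _ hd.ne'
  have hk0 : 0 ≤ k := div_nonneg hc hd.le
  refine ⟨fun i j => (if i = a then if j = b then k else 0 else 0) +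
    (if i = b then if j = a then k else 0 else 0), fun i j => ?_, fun i => ?_, fun i => ?_⟩
  · dsimp only
    split_ifs <;> simp [hk0]
  · by_cases hia : i = a <;> by_cases hib : i = b <;>
      simp [hia, hib, hne, hne.symm]
  · by_cases hia : i = a
    · subst hia
      simp [hne, ite_mul]
      linarith
    · by_cases hib : i = b
      · subst hib
        simp [hne.symm, ite_mul]
        linarith
      · simp [hia, hib]

/-- A balanced vector whose sum over every upper set of the density ratio `p / pstar` is
nonpositive belongs to the local order cone. -/
lemma mem_localCone_of_sum_nonpos {n : ℕ} {p pstar : Fin n → ℝ} (hps : ∀ i, 0 < pstar i)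
    (v : Fin n → ℝ) (hsum : ∑ i, v i = 0)
    (hv : ∀ A : Finset (Fin n),
      (∀ i ∈ A, ∀ j, p i / pstar i < p j / pstar j → j ∈ A) → ∑ i ∈ A, v i ≤ 0) :
    v ∈ localCone n p pstar := by
  induction hN : (Finset.univ.filter fun i => v i ≠ 0).card using Nat.strong_induction_on
    generalizing v with
  | _ N ih =>
  set x : Fin n → ℝ := fun i => p i / pstar i with hx
  by_cases hpos : (Finset.univ.filter fun i => 0 < v i).Nonempty
  · obtain ⟨b, hb, hbmax⟩ := Finset.exists_max_image _ x hpos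
    simp only [Finset.mem_filter, Finset.mem_univ, true_and] at hb hbmax
    have habove : ∀ i, x b < x i → v i ≤ 0 := fun i hi =>
      not_lt.1 fun h => absurd (hbmax i h) (not_le.2 hi)
    obtain ⟨a, hxa, hva⟩ : ∃ a, x b < x a ∧ v a < 0 := by
      by_contra! hcon
      have h := hv (insert b (Finset.univ.filter fun i => x b < x i)) (by
        intro i hi j hij
        simp only [Finset.mem_insert, Finset.mem_filter, Finset.mem_univ, true_and] at hi ⊢
        right
        rcases hi with rfl | hi
        · exact hij
        · exact hi.trans hij)
      rw [Finset.sum_insert (by simp)] at h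
      have h2 : 0 ≤ ∑ i ∈ Finset.univ.filter (fun i => x b < x i), v i :=
        Finset.sum_nonneg fun i hi => hcon i (by simpa using hi)
      linarith
    have hne : a ≠ b := by rintro rfl; exact lt_irrefl _ hxa
    set δ := min (v b) (-v a) with hδ
    have hδ0 : 0 < δ := lt_min hb (neg_pos.2 hva)
    have hδb : δ ≤ v b := min_le_left _ _
    have hδa : δ ≤ -v a := min_le_right _ _
    set d : Fin n → ℝ := Pi.single b δ - Pi.single a δ with hd
    have hda : d a = -δ := by simp [hd, hne]
    have hdb : d b = δ := by simp [hd, hne.symm]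
    have hdo : ∀ i, i ≠ a → i ≠ b → d i = 0 := fun i hia hib => by simp [hd, hia, hib]
    have hdsum : ∀ A : Finset (Fin n), ∑ i ∈ A, d i =
        (if b ∈ A then δ else 0) - (if a ∈ A then δ else 0) := fun A => by
      simp [hd, Finset.sum_sub_distrib]
    have key : v - d ∈ localCone n p pstar := by
      refine ih _ ?_ (v - d) ?_ ?_ rfl
      · rw [← hN]
        refine Finset.card_lt_card (Finset.ssubset_iff_of_subset ?_ |>.2 ?_)
        · intro i hi
          simp only [Finset.mem_filter, Finset.mem_univ, true_and, Pi.sub_apply] at hi ⊢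
          by_cases hia : i = a
          · subst hia; exact hva.ne
          · by_cases hib : i = b
            · subst hib; exact hb.ne'
            · simpa [hdo i hia hib] using hi
        · rcases min_choice (v b) (-v a) with h | h
          · refine ⟨b, by simpa using hb.ne', ?_⟩
            simp [hdb, hδ, h]
          · refine ⟨a, by simpa using hva.ne, ?_⟩
            simp [hda, hδ, h]
      · simp [Finset.sum_sub_distrib, hsum, hdsum]
      · intro A hA
        have hvA := hv A hA
        simp only [Pi.sub_apply, Finset.sum_sub_distrib, hdsum]
        by_cases hbA : b ∈ A
        · have haA : a ∈ A := hA b hbA a hxa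
          simpa [hbA, haA] using hvA
        by_cases haA : a ∈ A
        · simp only [hbA, haA, if_true, if_false]
          have hge : ∀ i ∈ A, x b ≤ x i := fun i hi =>
            not_lt.1 fun h => hbA (hA i hi b h)
          by_cases hlev : ∃ i ∈ A, x i = x b
          · obtain ⟨c, hcA, hcb⟩ := hlev
            have h := hv (insert b A) (by
              intro i hi j hij
              rw [Finset.mem_insert] at hi ⊢
              right
              rcases hi with rfl | hi
              · exact hA c hcA j (by rw [show p c / pstar c = p i / pstar i from hcb]; exact hij)
              · exact hA i hi j hij)
            rw [Finset.sum_insert hbA] at h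
            linarith
          · push Not at hlev
            have h : ∑ i ∈ A.erase a, v i ≤ 0 := Finset.sum_nonpos fun i hi =>
              have hi := Finset.mem_of_mem_erase hi
              habove i (lt_of_le_of_ne (hge i hi) (hlev i hi).symm)
            rw [← Finset.add_sum_erase _ _ haA]
            linarith
        · simpa [hbA, haA] using hvA
    have h := add_mem_localCone hps key (single_sub_single_mem_localCone hps hxa hδ0.le)
    rwa [← hd, sub_add_cancel] at h
  · have hle : ∀ i, v i ≤ 0 := fun i => not_lt.1 fun h => hpos ⟨i, by simpa using h⟩
    have h0 : v = 0 := funext fun i =>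
      (Finset.sum_eq_zero_iff_of_nonpos fun i _ => hle i).1 hsum i (Finset.mem_univ i)
    exact h0 ▸ zero_mem_localCone hps

/-- The derivative of a convex `f`-divergence from equilibrium is nonpositive along the
local order cone. -/
lemma sum_mul_nonpos_of_mem_localCone {n : ℕ} {p pstar v : Fin n → ℝ} (hps : ∀ i, 0 < pstar i)
    {φ φ' : ℝ → ℝ} (hφ : ∀ a b, φ' a * (b - a) ≤ φ b - φ a) (hv : v ∈ localCone n p pstar) :
    ∑ i, φ' (p i / pstar i) * v i ≤ 0 := by
  obtain ⟨w, hw, hbal, hwv⟩ := (mem_localCone_iff hps).1 hv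
  calc ∑ i, φ' (p i / pstar i) * v i
      = ∑ i, ∑ j, w i j * (φ' (p i / pstar i) * (p j / pstar j - p i / pstar i)) := by
        refine Finset.sum_congr rfl fun i _ => ?_
        rw [hwv i, Finset.mul_sum]
        exact Finset.sum_congr rfl fun j _ => by ring
    _ ≤ ∑ i, ∑ j, w i j * (φ (p j / pstar j) - φ (p i / pstar i)) :=
        Finset.sum_le_sum fun i _ => Finset.sum_le_sum fun j _ =>
          mul_le_mul_of_nonneg_left (hφ _ _) (hw i j)
    _ = ∑ i, ∑ j, w i j * φ (p j / pstar j) - ∑ i, ∑ j, w i j * φ (p i / pstar i) := by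
        simp only [mul_sub, Finset.sum_sub_distrib]
    _ = 0 := by
        rw [Finset.sum_comm, sub_eq_zero]
        refine Finset.sum_congr rfl fun i _ => ?_
        rw [← Finset.sum_mul, ← Finset.sum_mul, hbal i]

/-- A convex `f`-divergence from equilibrium does not increase along a smooth curve directed by
the local order cones. -/
lemma divergence_le_of_hasDerivWithinAt {n : ℕ} {pstar : Fin n → ℝ} (hps : ∀ i, 0 < pstar i)
    {φ φ' : ℝ → ℝ} (hφ : ∀ a b, φ' a * (b - a) ≤ φ b - φ a)
    (hφ' : ∀ a, HasDerivAt φ (φ' a) a) {P D : ℝ → Fin n → ℝ} {a b : ℝ} (hab : a ≤ b)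
    (hP : ∀ t ∈ Set.Icc a b, (∀ i, HasDerivWithinAt (fun r => P r i) (D t i) (Set.Icc a b) t) ∧
      D t ∈ localCone n (P t) pstar) :
    ∑ i, pstar i * φ (P b i / pstar i) ≤ ∑ i, pstar i * φ (P a i / pstar i) := by
  have hder : ∀ t ∈ Set.Icc a b,
      HasDerivWithinAt (fun r => ∑ i, pstar i * φ (P r i / pstar i))
        (∑ i, φ' (P t i / pstar i) * D t i) (Set.Icc a b) t := by
    intro t ht
    refine HasDerivWithinAt.fun_sum fun i _ => ?_
    have h := (((hφ' (P t i / pstar i)).comp_hasDerivWithinAt t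
      (((hP t ht).1 i).div_const (pstar i))).const_mul (pstar i))
    refine h.congr_deriv ?_
    have := (hps i).ne'
    field_simp
  refine antitoneOn_of_hasDerivWithinAt_nonpos (convex_Icc a b)
    (fun t ht => (hder t ht).continuousWithinAt)
    (fun t ht => (hder t (interior_subset ht)).mono interior_subset)
    (fun t ht => sum_mul_nonpos_of_mem_localCone hps hφ (hP t (interior_subset ht)).2)
    (Set.left_mem_Icc.2 hab) (Set.right_mem_Icc.2 hab) hab

lemma hasDerivAt_sqrt_sub_sq_add {θ ε : ℝ} (hε : 0 < ε) (a : ℝ) :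
    HasDerivAt (fun y => √((y - θ) ^ 2 + ε ^ 2)) ((a - θ) / √((a - θ) ^ 2 + ε ^ 2)) a := by
  have h2 : HasDerivAt (fun y => (y - θ) ^ 2 + ε ^ 2) (2 * (a - θ)) a := by
    simpa using (((hasDerivAt_id a).sub_const θ).fun_pow 2).add_const (ε ^ 2)
  exact (h2.sqrt (by positivity)).congr_deriv (mul_div_mul_left _ _ two_ne_zero)

lemma div_sqrt_mul_sub_le {θ ε : ℝ} (hε : 0 < ε) (a b : ℝ) :
    (a - θ) / √((a - θ) ^ 2 + ε ^ 2) * (b - a) ≤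
      √((b - θ) ^ 2 + ε ^ 2) - √((a - θ) ^ 2 + ε ^ 2) := by
  have hA : 0 < (a - θ) ^ 2 + ε ^ 2 := by positivity
  have hs : 0 < √((a - θ) ^ 2 + ε ^ 2) := Real.sqrt_pos.2 hA
  have hcs : (a - θ) * (b - θ) + ε ^ 2 ≤ √((a - θ) ^ 2 + ε ^ 2) * √((b - θ) ^ 2 + ε ^ 2) := by
    rw [← Real.sqrt_mul hA.le]
    apply Real.le_sqrt_of_sq_le
    nlinarith [sq_nonneg (ε * (a - b))]
  rw [div_mul_eq_mul_div, div_le_iff₀ hs]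
  nlinarith [Real.mul_self_sqrt hA.le]

/-- if `P⁰` precedes `P¹` in the Markov order with equilibrium `pstar`
(i.e. they are joined by a continuous, piecewise continuously differentiable curve in the
probability simplex whose derivative lies in the local order cone wherever it exists),
then `P¹ − P⁰` lies in the local order cone at `P⁰`. -/
theorem markov_order_implies_local_order
    (n : ℕ) (pstar : Fin n → ℝ) (hps : ∀ i, 0 < pstar i) (hps1 : ∑ i, pstar i = 1)
    (P0 P1 : Fin n → ℝ)
    (hP0 : (∀ i, 0 ≤ P0 i) ∧ ∑ i, P0 i = 1)
    (hP1 : (∀ i, 0 ≤ P1 i) ∧ ∑ i, P1 i = 1)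
    (m : ℕ) (τ : Fin (m + 1) → ℝ)
    (hτmono : Monotone τ) (hτ0 : τ 0 = 0) (hτlast : τ (Fin.last m) = 1)
    (P : ℝ → Fin n → ℝ)
    (hPcont : ∀ i, ContinuousOn (fun t => P t i) (Set.Icc (0:ℝ) 1))
    (hstart : P 0 = P0) (hend : P 1 = P1)
    (hsimplex : ∀ t ∈ Set.Icc (0:ℝ) 1, (∀ i, 0 ≤ P t i) ∧ ∑ i, P t i = 1)
    (hpieces : ∀ s : Fin m, ∃ D : ℝ → Fin n → ℝ,
      (∀ i, ContinuousOn (fun t => D t i) (Set.Icc (τ s.castSucc) (τ s.succ))) ∧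
      ∀ t ∈ Set.Icc (τ s.castSucc) (τ s.succ),
        (∀ i, HasDerivWithinAt (fun r => P r i) (D t i)
          (Set.Icc (τ s.castSucc) (τ s.succ)) t) ∧
        D t ∈ localCone n (P t) pstar) :
    (fun i => P1 i - P0 i) ∈ localCone n P0 pstar := by
  have hsmooth : ∀ θ ε : ℝ, 0 < ε →
      ∑ i, pstar i * √((P1 i / pstar i - θ) ^ 2 + ε ^ 2) ≤
        ∑ i, pstar i * √((P0 i / pstar i - θ) ^ 2 + ε ^ 2) := by
    intro θ ε hε
    have h : ∀ s : Fin (m + 1), ∑ i, pstar i * √((P (τ s) i / pstar i - θ) ^ 2 + ε ^ 2) ≤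
        ∑ i, pstar i * √((P0 i / pstar i - θ) ^ 2 + ε ^ 2) := by
      intro s
      induction s using Fin.induction with
      | zero => rw [hτ0, hstart]
      | succ s ih =>
        obtain ⟨D, -, hD⟩ := hpieces s
        exact (divergence_le_of_hasDerivWithinAt hps (div_sqrt_mul_sub_le hε)
          (hasDerivAt_sqrt_sub_sq_add hε) (hτmono s.castSucc_le_succ) hD).trans ih
    have hl := h (Fin.last m)
    rwa [hτlast, hend] at hl
  have habs : ∀ θ : ℝ, ∑ i, |P1 i - θ * pstar i| ≤ ∑ i, |P0 i - θ * pstar i| := by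
    intro θ
    have hscale : ∀ (p : Fin n → ℝ) i, |p i - θ * pstar i| = pstar i * |p i / pstar i - θ| := by
      intro p i
      rw [← abs_of_pos (hps i), ← abs_mul, abs_of_pos (hps i), mul_sub,
        mul_div_cancel₀ _ (hps i).ne', mul_comm θ]
    refine le_of_forall_pos_le_add fun ε hε => ?_
    simp only [hscale]
    calc ∑ i, pstar i * |P1 i / pstar i - θ|
        ≤ ∑ i, pstar i * √((P1 i / pstar i - θ) ^ 2 + ε ^ 2) :=
          Finset.sum_le_sum fun i _ => mul_le_mul_of_nonneg_left
            (Real.abs_le_sqrt (le_add_of_nonneg_right (sq_nonneg ε))) (hps i).le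
      _ ≤ ∑ i, pstar i * √((P0 i / pstar i - θ) ^ 2 + ε ^ 2) := hsmooth θ ε hε
      _ ≤ ∑ i, pstar i * (|P0 i / pstar i - θ| + ε) := by
          refine Finset.sum_le_sum fun i _ => mul_le_mul_of_nonneg_left ?_ (hps i).le
          rw [Real.sqrt_le_left (by positivity)]
          nlinarith [sq_abs (P0 i / pstar i - θ), abs_nonneg (P0 i / pstar i - θ)]
      _ = ∑ i, pstar i * |P0 i / pstar i - θ| + ε := by
          simp only [mul_add, Finset.sum_add_distrib, ← Finset.sum_mul, hps1, one_mul]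
  refine mem_localCone_of_sum_nonpos hps _ (by simp [Finset.sum_sub_distrib, hP0.2, hP1.2]) ?_
  intro A hA
  rcases A.eq_empty_or_nonempty with rfl | hne
  · simp
  obtain ⟨c, hcA, hc⟩ := Finset.exists_min_image A (fun i => P0 i / pstar i) hne
  set θ := P0 c / pstar c with hθ
  have hsplit : ∀ f : Fin n → ℝ, ∑ i ∈ A, f i + ∑ i ∈ Aᶜ, f i = ∑ i, f i :=
    fun f => Finset.sum_add_sum_compl A f
  have hin : ∑ i ∈ A, |P0 i - θ * pstar i| = ∑ i ∈ A, (P0 i - θ * pstar i) :=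
    Finset.sum_congr rfl fun i hi => abs_of_nonneg
      (sub_nonneg.2 ((le_div_iff₀ (hps i)).1 (hc i hi)))
  have hout : ∑ i ∈ Aᶜ, |P0 i - θ * pstar i| = ∑ i ∈ Aᶜ, -(P0 i - θ * pstar i) :=
    Finset.sum_congr rfl fun i hi => abs_of_nonpos (sub_nonpos.2 ((div_le_iff₀ (hps i)).1
      (not_lt.1 fun h => Finset.mem_compl.1 hi (hA c hcA i h))))
  have hin1 : ∑ i ∈ A, (P1 i - θ * pstar i) ≤ ∑ i ∈ A, |P1 i - θ * pstar i| :=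
    Finset.sum_le_sum fun i _ => le_abs_self _
  have hout1 : ∑ i ∈ Aᶜ, -(P1 i - θ * pstar i) ≤ ∑ i ∈ Aᶜ, |P1 i - θ * pstar i| :=
    Finset.sum_le_sum fun i _ => neg_le_abs _
  have hle := habs θ
  rw [← hsplit, ← hsplit fun i => |P0 i - θ * pstar i|, hin, hout] at hle
  have h0 := hsplit P0
  have h1 := hsplit P1
  rw [hP0.2] at h0
  rw [hP1.2] at h1
  simp only [Finset.sum_sub_distrib, Finset.sum_neg_distrib] at *
  linarith
end

section
/- Let P* be a positive probability distribution on n states and let σ : {1,…,n} → {1,…,k+1} be a surjection. Define the compartment C_σ as the set of probability distributions P such that p_i/p*_i = p_j/p*_j whenever σ(i) = σ(j) and p_i/p*_i > p_j/p*_j whenever σ(j) = σ(i)+1. Then for every P ∈ C_σ the local order cone satisfies Q_{(P,P*)} = cone{ γ^{ij} : σ(j) = σ(i)+1 }, the conic hull of the Σ_{i=1}^{k} k_i k_{i+1} vectors γ^{ij} for which j lies one row below i in the tableau of σ (k_i being the number of elements of the preimage σ^{-1}(i)). -/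
open Finset

/-- A vector of total mass zero that is nonpositive on `U` and nonnegative off `U` is a conic
combination of transports from `U` to its complement. -/
theorem mem_of_sum_eq_zero_of_sign {n : ℕ} (C : PointedCone ℝ (Fin n → ℝ))
    (U : Fin n → Prop) [DecidablePred U]
    (hC : ∀ i j, U i → ¬ U j → gammaVec n i j ∈ C) (u : Fin n → ℝ)
    (hU : ∀ i, U i → u i ≤ 0) (hU' : ∀ i, ¬ U i → 0 ≤ u i) (hu : ∑ i, u i = 0) : u ∈ C := by
  set a : Fin n → ℝ := fun i => if U i then -u i else 0 with ha
  set b : Fin n → ℝ := fun i => if U i then 0 else u i with hb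
  have ha0 : ∀ i, 0 ≤ a i := by
    intro i; by_cases h : U i <;> simp [ha, h]
    exact hU i h
  have hb0 : ∀ i, 0 ≤ b i := by
    intro i; by_cases h : U i <;> simp [hb, h]
    exact hU' i h
  have hab : ∀ i, u i = b i - a i := by
    intro i; by_cases h : U i <;> simp [ha, hb, h]
  have hT : ∑ i, a i = ∑ i, b i := by
    have := hu
    simp only [hab, sum_sub_distrib] at this
    linarith
  by_cases hz : ∑ i, b i = 0
  · have hbz := (sum_eq_zero_iff_of_nonneg fun i _ => hb0 i).1 hz
    have haz := (sum_eq_zero_iff_of_nonneg fun i _ => ha0 i).1 (hT.trans hz)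
    have : u = 0 := by
      funext i
      simp [hab, hbz i (mem_univ i), haz i (mem_univ i)]
    exact this ▸ C.zero_mem
  · have key : u = ∑ i, ∑ j, (a i * b j / ∑ l, b l) • gammaVec n i j := by
      funext l
      have h1 : ∑ i, a i * b l / ∑ l, b l = b l := by
        rw [← sum_div, ← sum_mul, hT]; field_simp
      have h2 : ∑ j, a l * b j / ∑ l, b l = a l := by
        rw [← sum_div, ← mul_sum]; field_simp
      simp only [Finset.sum_apply, Pi.smul_apply, gammaVec, smul_eq_mul, mul_sub,
        sum_sub_distrib, mul_ite, mul_one, mul_zero, sum_ite_eq, mem_univ, if_true]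
      rw [h1, sum_comm]
      simp only [sum_ite_eq, mem_univ, if_true]
      rw [h2, hab]
    rw [key]
    refine C.sum_mem fun i _ => C.sum_mem fun j _ => ?_
    by_cases hi : U i
    · by_cases hj : U j
      · simp [hb, hj]
      · exact C.smul_mem (div_nonneg (mul_nonneg (ha0 i) (hb0 j))
          (sum_nonneg fun l _ => hb0 l)) (hC i j hi hj)
    · simp [ha, hi]

/-- A cone containing all transports between consecutive layers of `σ` contains all transports
from a layer to any later one. -/
theorem gammaVec_mem_of_lt {n k : ℕ} {σ : Fin n → Fin (k + 1)} (hσ : Function.Surjective σ)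
    (C : PointedCone ℝ (Fin n → ℝ))
    (hC : ∀ i j, (σ j : ℕ) = (σ i : ℕ) + 1 → gammaVec n i j ∈ C) :
    ∀ i j, (σ i : ℕ) < (σ j : ℕ) → gammaVec n i j ∈ C := by
  have key : ∀ d : ℕ, ∀ i j, (σ j : ℕ) = (σ i : ℕ) + 1 + d → gammaVec n i j ∈ C := by
    intro d
    induction d with
    | zero => exact hC
    | succ d ih =>
      intro i j hij
      obtain ⟨l, hl⟩ := hσ ⟨(σ i : ℕ) + 1, by have := (σ j).isLt; omega⟩
      have hl' : (σ l : ℕ) = (σ i : ℕ) + 1 := by rw [hl]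
      have : gammaVec n i j = gammaVec n i l + gammaVec n l j := by
        funext m; simp [gammaVec]
      rw [this]
      exact C.add_mem (hC i l hl') (ih l j (by omega))
  intro i j hij
  exact key ((σ j : ℕ) - (σ i : ℕ) - 1) i j (by omega)

/-- The vector of net inflows of a circulation `w` from `U` is a conic combination of transports
from `U` to its complement. -/
theorem circulation_indicator_mem {n : ℕ} (C : PointedCone ℝ (Fin n → ℝ))
    (U : Fin n → Prop) [DecidablePred U]
    (hC : ∀ i j, U i → ¬ U j → gammaVec n i j ∈ C) (w : Fin n → Fin n → ℝ)
    (hw : ∀ i j, 0 ≤ w i j) (hbal : ∀ i, ∑ j, w i j = ∑ j, w j i) :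
    (fun i => ∑ j, w i j * ((if U j then 1 else 0) - (if U i then 1 else 0))) ∈ C := by
  refine mem_of_sum_eq_zero_of_sign C U hC _ (fun i hi => ?_) (fun i hi => ?_) ?_
  · refine sum_nonpos fun j _ => mul_nonpos_of_nonneg_of_nonpos (hw i j) ?_
    split_ifs <;> simp
  · refine sum_nonneg fun j _ => mul_nonneg (hw i j) ?_
    split_ifs <;> simp
  · simp only [mul_sub, sum_sub_distrib]
    rw [sum_comm]
    simp only [← sum_mul, hbal, sub_self]

/-- Layer decomposition of the differences of a function that is constant on the layers of
`σ`. -/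
theorem sub_eq_sum_layers {n k : ℕ} (σ : Fin n → Fin (k + 1)) (r : Fin n → ℝ) (R : ℕ → ℝ)
    (hR : ∀ i, r i = R (σ i)) (i j : Fin n) :
    r j - r i = ∑ m ∈ range k, (R m - R (m + 1)) *
      ((if (σ j : ℕ) ≤ m then 1 else 0) - (if (σ i : ℕ) ≤ m then 1 else 0)) := by
  have key : ∀ s : ℕ, s ≤ k →
      ∑ m ∈ range k, (R m - R (m + 1)) * (if s ≤ m then 1 else 0) = R s - R k := by
    intro s hs
    simp only [mul_ite, mul_one, mul_zero]
    rw [← sum_filter, ← neg_sub (R k), ← sum_Ico_sub R hs, ← sum_neg_distrib]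
    refine sum_congr ?_ fun m _ => by ring
    ext m
    simp only [mem_filter, mem_range, mem_Ico]
    omega
  have hj := key _ (Nat.lt_succ_iff.1 (σ j).isLt)
  have hi := key _ (Nat.lt_succ_iff.1 (σ i).isLt)
  simp_rw [mul_sub (R _ - _), sum_sub_distrib]
  rw [hi, hj, hR, hR]
  ring

/-- The drift of a circulation along a function decreasing in the layers of `σ` lies in every cone
containing the transports between consecutive layers. -/
theorem circulation_drift_mem {n k : ℕ} {σ : Fin n → Fin (k + 1)} (hσ : Function.Surjective σ)
    (C : PointedCone ℝ (Fin n → ℝ))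
    (hC : ∀ i j, (σ j : ℕ) = (σ i : ℕ) + 1 → gammaVec n i j ∈ C) (r : Fin n → ℝ)
    (heq : ∀ i j, σ i = σ j → r i = r j)
    (hlt : ∀ i j, (σ j : ℕ) = (σ i : ℕ) + 1 → r j ≤ r i)
    (w : Fin n → Fin n → ℝ)
    (hw : ∀ i j, 0 ≤ w i j) (hbal : ∀ i, ∑ j, w i j = ∑ j, w j i) :
    (fun i => ∑ j, w i j * (r j - r i)) ∈ C := by
  obtain ⟨τ, hτ⟩ := hσ.hasRightInverse
  set R : ℕ → ℝ := fun m => if h : m < k + 1 then r (τ ⟨m, h⟩) else 0 with hRdef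
  have hR : ∀ i, r i = R (σ i) := by
    intro i
    simp only [hRdef, (σ i).isLt, dif_pos, Fin.eta]
    exact heq _ _ (hτ _).symm
  have hanti : ∀ m ∈ range k, 0 ≤ R m - R (m + 1) := by
    intro m hm
    have hm := mem_range.1 hm
    simp only [hRdef, dif_pos (show m < k + 1 by omega), dif_pos (show m + 1 < k + 1 by omega)]
    exact sub_nonneg.2 (hlt _ _ (by rw [hτ, hτ]))
  have key : (fun i => ∑ j, w i j * (r j - r i)) = ∑ m ∈ range k, (R m - R (m + 1)) •
      fun i => ∑ j, w i j *
        ((if (σ j : ℕ) ≤ m then 1 else 0) - (if (σ i : ℕ) ≤ m then 1 else 0)) := by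
    funext i
    simp only [Finset.sum_apply, Pi.smul_apply, smul_eq_mul, mul_sum]
    rw [sum_comm]
    refine sum_congr rfl fun j _ => ?_
    rw [sub_eq_sum_layers σ r R hR i j, mul_sum]
    exact sum_congr rfl fun m _ => by ring
  rw [key]
  refine C.sum_mem fun m hm => C.smul_mem (hanti m hm) ?_
  refine circulation_indicator_mem C (fun i => (σ i : ℕ) ≤ m) (fun i j hi hj => ?_) w hw hbal
  exact gammaVec_mem_of_lt hσ C hC i j (by omega)

/-- The conic hull of the vectors `γ^{ij}` with `E i j`. -/
def gammaCone (n : ℕ) (E : Fin n → Fin n → Prop) [∀ i j, Decidable (E i j)] :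
    PointedCone ℝ (Fin n → ℝ) where
  carrier := {v | ∃ c : Fin n → Fin n → ℝ, (∀ i j, 0 ≤ c i j) ∧
    v = ∑ i, ∑ j, if E i j then c i j • gammaVec n i j else 0}
  zero_mem' := ⟨0, fun _ _ => le_rfl, by simp⟩
  add_mem' := by
    rintro _ _ ⟨c, hc, rfl⟩ ⟨d, hd, rfl⟩
    refine ⟨c + d, fun i j => add_nonneg (hc i j) (hd i j), ?_⟩
    simp only [← sum_add_distrib]
    refine sum_congr rfl fun i _ => sum_congr rfl fun j _ => ?_
    split_ifs <;> simp [add_smul]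
  smul_mem' := by
    rintro ⟨a, ha⟩ _ ⟨c, hc, rfl⟩
    refine ⟨a • c, fun i j => mul_nonneg ha (hc i j), ?_⟩
    change a • (∑ i, ∑ j, if E i j then c i j • gammaVec n i j else 0) = _
    simp only [smul_sum]
    refine sum_congr rfl fun i _ => sum_congr rfl fun j _ => ?_
    split_ifs <;> simp [mul_smul]

theorem gammaVec_mem_gammaCone {n : ℕ} {E : Fin n → Fin n → Prop} [∀ i j, Decidable (E i j)]
    {i j : Fin n} (h : E i j) : gammaVec n i j ∈ gammaCone n E := by
  refine ⟨fun a b => if a = i ∧ b = j then 1 else 0, fun a b => by positivity, ?_⟩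
  rw [Fintype.sum_eq_single i, Fintype.sum_eq_single j]
  · simp [h]
  · intro b hb; simp [hb]
  · intro a ha; simp [ha]

/-- Weighted transports along edges on which `p / pstar` strictly decreases are realised by a
reversible Markov process. -/
theorem sum_gammaVec_mem_localCone {n : ℕ} {p pstar : Fin n → ℝ} (hps : ∀ i, 0 < pstar i)
    {E : Fin n → Fin n → Prop} [∀ i j, Decidable (E i j)]
    (hE : ∀ i j, E i j → p j / pstar j < p i / pstar i)
    {c : Fin n → Fin n → ℝ} (hc : ∀ i j, 0 ≤ c i j) :
    (∑ i, ∑ j, if E i j then c i j • gammaVec n i j else 0) ∈ localCone n p pstar := by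
  set r : Fin n → ℝ := fun i => p i / pstar i with hr
  set s : Fin n → Fin n → ℝ := fun i j => if E i j then c i j / (r i - r j) else 0 with hs
  have hs0 : ∀ i j, 0 ≤ s i j := by
    intro i j
    simp only [hs]
    split_ifs with h
    · exact div_nonneg (hc i j) (sub_nonneg.2 (hE i j h).le)
    · exact le_rfl
  have hsr : ∀ i j, s i j * (r i - r j) = if E i j then c i j else 0 := by
    intro i j
    simp only [hs]
    split_ifs with h
    · exact div_mul_cancel₀ _ (sub_pos.2 (hE i j h)).ne'
    · exact zero_mul _
  have hq : ∀ i j, (s i j + s j i) / pstar j * pstar j = s i j + s j i := fun i j =>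
    div_mul_cancel₀ _ (hps j).ne'
  refine ⟨fun i j => (s i j + s j i) / pstar j, fun i j _ =>
    div_nonneg (add_nonneg (hs0 i j) (hs0 j i)) (hps j).le, fun i => ?_, fun i => ?_⟩
  · rw [sum_mul]
    refine sum_congr rfl fun j _ => ?_
    rw [hq, hq, add_comm]
  · simp only [hq]
    rw [sum_erase _ (by simp)]
    have h : ∀ a b, (if E a b then c a b • gammaVec n a b else 0) i
        = (s a b * (r a - r b)) * gammaVec n a b i := by
      intro a b
      rw [hsr]
      split_ifs <;> simp
    simp only [Finset.sum_apply, h, gammaVec, mul_sub (_ * _), sum_sub_distrib, mul_ite, mul_one,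
      mul_zero, sum_ite_eq, mem_univ, if_true]
    rw [sum_comm (f := fun a b => if i = a then s a b * (r a - r b) else 0)]
    simp only [sum_ite_eq, mem_univ, if_true]
    rw [← sum_sub_distrib]
    refine sum_congr rfl fun j _ => ?_
    change _ = (s i j + s j i) * (r j - r i)
    ring

/-- on the compartment `C_σ` determined by a surjection
`σ : {1,…,n} → {1,…,k+1}` (here `σ : Fin n → Fin (k+1)`), the local order cone equals the
conic hull of the vectors `γ^{ij}` for which `σ(j) = σ(i) + 1`. -/
theorem localCone_on_compartment
    (n k : ℕ) (pstar : Fin n → ℝ) (hps : ∀ i, 0 < pstar i) (hps1 : ∑ i, pstar i = 1)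
    (σ : Fin n → Fin (k + 1)) (hσ : Function.Surjective σ)
    (p : Fin n → ℝ) (hp : ∀ i, 0 ≤ p i) (hp1 : ∑ i, p i = 1)
    (heq : ∀ i j, σ i = σ j → p i / pstar i = p j / pstar j)
    (hlt : ∀ i j, (σ j : ℕ) = (σ i : ℕ) + 1 → p j / pstar j < p i / pstar i) :
    localCone n p pstar =
      {v | ∃ c : Fin n → Fin n → ℝ, (∀ i j, 0 ≤ c i j) ∧
        v = ∑ i, ∑ j, if (σ j : ℕ) = (σ i : ℕ) + 1 then c i j • gammaVec n i j else 0} := by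
  apply Set.Subset.antisymm
  · rintro v ⟨q, hq, hbal, hv⟩
    set w : Fin n → Fin n → ℝ := fun i j => if j = i then 0 else q i j * pstar j with hw
    have hrow : ∀ i (g : Fin n → ℝ),
        ∑ j, w i j * g j = ∑ j ∈ univ.erase i, q i j * pstar j * g j := by
      intro i g
      rw [← sum_erase (a := i) univ (by simp [hw])]
      exact sum_congr rfl fun j hj => by simp [hw, (mem_erase.1 hj).1]
    have hcol : ∀ i, ∑ j, w j i = (∑ j ∈ univ.erase i, q j i) * pstar i := by
      intro i
      rw [← sum_erase (a := i) univ (by simp [hw]), sum_mul]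
      exact sum_congr rfl fun j hj => by simp [hw, (mem_erase.1 hj).1.symm]
    have hvw : v = fun i => ∑ j, w i j * (p j / pstar j - p i / pstar i) := by
      funext i
      rw [hv, hrow]
    rw [hvw]
    refine circulation_drift_mem hσ (gammaCone n fun i j => (σ j : ℕ) = (σ i : ℕ) + 1)
      (fun i j h => gammaVec_mem_gammaCone h) (fun i => p i / pstar i) heq
      (fun i j h => (hlt i j h).le) w (fun i j => ?_) (fun i => ?_)
    · simp only [hw]
      split_ifs with h
      · exact le_rfl
      · exact mul_nonneg (hq i j (Ne.symm h)) (hps j).le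
    · rw [hcol, ← hbal]
      simpa using hrow i 1
  · rintro _ ⟨c, hc, rfl⟩
    exact sum_gammaVec_mem_localCone hps hlt hc
end

section
/- Let φ : (0,∞) → ℝ be twice continuously differentiable and satisfy, for all positive real numbers x₁, x₂, x₃ and y₁, the functional equation φ(x₁y₁)(φ(x₃) − φ(x₂)) + φ(x₂y₁)(φ(x₁) − φ(x₃)) + φ(x₃y₁)(φ(x₂) − φ(x₁)) = 0. Then either there exist constants C₁, C₂ and a real exponent k such that φ(x) = C₁ x^k + C₂ for all x > 0, or there exist constants C₁, C₂ such that φ(x) = C₁ + C₂ ln x for all x > 0. -/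
open Set

/-- A function with vanishing derivative on `(0,∞)` is constant there. -/
theorem eq_apply_one_of_hasDerivAt_zero {g : ℝ → ℝ} (hg : ∀ x, 0 < x → HasDerivAt g 0 x)
    {x : ℝ} (hx : 0 < x) : g x = g 1 :=
  isOpen_Ioi.is_const_of_deriv_eq_zero (convex_Ioi (0 : ℝ)).isPreconnected
    (fun z hz => (hg z hz).differentiableAt.differentiableWithinAt)
    (fun z hz => (hg z hz).deriv) hx (mem_Ioi.2 one_pos)

/-- Solutions on `(0,∞)` of the Euler equation `x φ' = c`. -/
theorem eq_add_mul_log_of_mul_deriv_eq {φ φ' : ℝ → ℝ} {c : ℝ}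
    (hd : ∀ x, 0 < x → HasDerivAt φ (φ' x) x) (hode : ∀ x, 0 < x → x * φ' x = c)
    {x : ℝ} (hx : 0 < x) : φ x = φ 1 + c * Real.log x := by
  have h := eq_apply_one_of_hasDerivAt_zero (g := fun x => φ x - c * Real.log x)
    (fun z hz => by
      refine ((hd z hz).sub ((Real.hasDerivAt_log hz.ne').const_mul c)).congr_deriv ?_
      rw [← hode z hz]
      field_simp
      ring) hx
  simp only [Real.log_one, mul_zero, sub_zero] at h
  linarith

/-- Solutions on `(0,∞)` of the Euler equation `x φ' = k φ + c` with `k ≠ 0`. -/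
theorem eq_mul_rpow_sub_of_mul_deriv_eq {φ φ' : ℝ → ℝ} {k c : ℝ} (hk : k ≠ 0)
    (hd : ∀ x, 0 < x → HasDerivAt φ (φ' x) x) (hode : ∀ x, 0 < x → x * φ' x = k * φ x + c)
    {x : ℝ} (hx : 0 < x) : φ x = (φ 1 + c / k) * x ^ k - c / k := by
  have h := eq_apply_one_of_hasDerivAt_zero (g := fun x => (φ x + c / k) * x ^ (-k))
    (fun z hz => by
      refine (((hd z hz).add_const (c / k)).mul
        (Real.hasDerivAt_rpow_const (p := -k) (Or.inl hz.ne'))).congr_deriv ?_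
      have hφ' : φ' z = (k * φ z + c) / z := by
        rw [← hode z hz]
        field_simp
      rw [hφ', Real.rpow_sub_one hz.ne']
      field_simp
      ring) hx
  simp only [Real.one_rpow, mul_one] at h
  rw [← h, mul_assoc, ← Real.rpow_add hx]
  simp

/-- the C² solutions on `(0,∞)` of the functional equation
`φ(x₁y₁)(φ(x₃) − φ(x₂)) + φ(x₂y₁)(φ(x₁) − φ(x₃)) + φ(x₃y₁)(φ(x₂) − φ(x₁)) = 0`
are exactly of the form `φ(x) = C₁ x^k + C₂` or `φ(x) = C₁ + C₂ ln x`. -/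
theorem functional_equation_solutions
    (φ : ℝ → ℝ) (hφ : ContDiffOn ℝ 2 φ (Set.Ioi 0))
    (heq : ∀ x₁ x₂ x₃ y₁ : ℝ, 0 < x₁ → 0 < x₂ → 0 < x₃ → 0 < y₁ →
      φ (x₁ * y₁) * (φ x₃ - φ x₂) + φ (x₂ * y₁) * (φ x₁ - φ x₃)
        + φ (x₃ * y₁) * (φ x₂ - φ x₁) = 0) :
    (∃ C₁ C₂ k : ℝ, ∀ x : ℝ, 0 < x → φ x = C₁ * x ^ k + C₂) ∨
    (∃ C₁ C₂ : ℝ, ∀ x : ℝ, 0 < x → φ x = C₁ + C₂ * Real.log x) := by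
  have hd : ∀ x, 0 < x → HasDerivAt φ (deriv φ x) x := fun x hx =>
    ((hφ.differentiableOn (by norm_num)).differentiableAt (Ioi_mem_nhds hx)).hasDerivAt
  by_cases hconst : ∀ x, 0 < x → φ x = φ 1
  · exact Or.inr ⟨φ 1, 0, fun x hx => by simp [hconst x hx]⟩
  push Not at hconst
  obtain ⟨a, ha, hne⟩ := hconst
  -- Differentiate the equation in `y₁` at `y₁ = 1`.
  have hlin : ∀ x, 0 < x → x * deriv φ x * (φ a - φ 1) + deriv φ 1 * (φ x - φ a)
      + a * deriv φ a * (φ 1 - φ x) = 0 := by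
    intro x hx
    have hscale : ∀ z, 0 < z → HasDerivAt (fun y => φ (z * y)) (z * deriv φ z) 1 := by
      intro z hz
      have hz1 : HasDerivAt φ (deriv φ z) (z * 1) := by
        rw [mul_one]
        exact hd z hz
      refine (hz1.comp 1 ((hasDerivAt_id (1 : ℝ)).const_mul z)).congr_deriv ?_
      ring
    have h := (((hscale x hx).mul_const (φ a - φ 1)).add
      ((hscale 1 one_pos).mul_const (φ x - φ a))).add
      ((hscale a ha).mul_const (φ 1 - φ x))
    have h0 := h.congr_of_eventuallyEq (f₁ := fun _ => (0 : ℝ)) (by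
      filter_upwards [Ioi_mem_nhds (one_pos : (0 : ℝ) < 1)] with y hy
      exact (heq x 1 a y hx one_pos ha hy).symm)
    simpa using h0.unique (hasDerivAt_const 1 0)
  have hne' : φ a - φ 1 ≠ 0 := sub_ne_zero.2 hne
  obtain ⟨k, c, hode⟩ : ∃ k c : ℝ, ∀ x, 0 < x → x * deriv φ x = k * φ x + c := by
    refine ⟨(a * deriv φ a - deriv φ 1) / (φ a - φ 1),
      (deriv φ 1 * φ a - a * deriv φ a * φ 1) / (φ a - φ 1), fun x hx => ?_⟩
    field_simp
    linarith [hlin x hx]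
  by_cases hk : k = 0
  · subst hk
    exact Or.inr ⟨φ 1, c, fun x hx =>
      eq_add_mul_log_of_mul_deriv_eq hd (fun z hz => by simpa using hode z hz) hx⟩
  · exact Or.inl ⟨φ 1 + c / k, -(c / k), k, fun x hx => by
      rw [eq_mul_rpow_sub_of_mul_deriv_eq hk hd hode hx, sub_eq_add_neg]⟩
end

section
/- Let A = (a_{ij}) be an n×n column-stochastic matrix (a_{ij} ≥ 0 and Σ_i a_{ij} = 1 for all j), and let ᾱ(A) = (1/2) max over pairs of columns j,k of Σ_i |a_{ij} − a_{ik}| be its ergodicity contraction coefficient (so 0 ≤ ᾱ(A) ≤ 1). Let h : (0,∞) → ℝ be convex and normalized: h(1) = 0 and h(x) ≥ 0 for all x > 0. Then for every pair of positive probability distributions P, Q on n states such that AP and AQ are positive, H_h(AP‖AQ) ≤ ᾱ(A) · H_h(P‖Q), where H_h(P‖Q) = Σ_i q_i h(p_i/q_i). -/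
open Finset

/-- Jensen's inequality for a convex function vanishing at `1`, where the weights `w` may have
total mass less than `b` and the missing mass is placed at the point `1`. -/
theorem ConvexOn.mul_map_div_le_sum_of_map_one_eq_zero {ι : Type*} [Fintype ι] {h : ℝ → ℝ}
    (hconv : ConvexOn ℝ (Set.Ioi 0) h) (h_one : h 1 = 0) {w x : ι → ℝ} {a b : ℝ}
    (hw : ∀ j, 0 ≤ w j) (hx : ∀ j, 0 < x j) (hb : 0 < b) (hwb : ∑ j, w j ≤ b)
    (hab : ∑ j, w j * (x j - 1) = a - b) :
    b * h (a / b) ≤ ∑ j, w j * h (x j) := by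
  have key := hconv.map_add_sum_le (t := univ) (w := fun j ↦ w j / b) (p := x)
    (v := 1 - (∑ j, w j) / b) (q := 1) (fun j _ ↦ div_nonneg (hw j) hb.le)
    (by rw [← sum_div]; ring) (fun j _ ↦ hx j)
    (sub_nonneg.2 ((div_le_one hb).2 hwb)) (by simp)
  have hpoint : (1 - (∑ j, w j) / b) • (1 : ℝ) + ∑ j, (w j / b) • x j = a / b := by
    simp only [smul_eq_mul, div_mul_eq_mul_div, ← sum_div]
    simp only [mul_sub, mul_one, sum_sub_distrib] at hab
    field_simp
    linarith
  rw [hpoint, h_one] at key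
  simp only [smul_eq_mul, mul_zero, zero_add, div_mul_eq_mul_div, ← sum_div] at key
  rwa [le_div_iff₀ hb, mul_comm] at key

/-- The total variation bound controls the positive part of the difference of two vectors of
equal mass. -/
theorem sum_posPart_sub_eq_half_sum_abs {ι : Type*} [Fintype ι] {u v : ι → ℝ}
    (huv : ∑ i, u i = ∑ i, v i) : ∑ i, (u i - v i)⁺ = 1 / 2 * ∑ i, |u i - v i| := by
  have hpos : ∀ i, (u i - v i)⁺ = 1 / 2 * |u i - v i| + 1 / 2 * (u i - v i) := fun i ↦ by
    linarith [posPart_add_negPart (u i - v i), posPart_sub_negPart (u i - v i)]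
  simp only [hpos, sum_add_distrib, ← mul_sum, sum_sub_distrib, huv]
  ring

/-- A nonnegative matrix acts on a given vector `d` of zero sum in the same way as an entrywise
smaller nonnegative matrix whose column sums are bounded by the contraction coefficient. -/
theorem Matrix.exists_le_mulVec_eq_of_sum_eq_zero {ι κ : Type*} [Fintype ι] [Fintype κ]
    {A : Matrix ι κ ℝ} (hA : ∀ i j, 0 ≤ A i j) {d : κ → ℝ} (hd : ∑ j, d j = 0) {α : ℝ}
    (hα : 0 ≤ α) (hαA : ∀ j k, ∑ i, (A i j - A i k)⁺ ≤ α) :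
    ∃ Z : Matrix ι κ ℝ, (∀ i j, 0 ≤ Z i j) ∧ (∀ i j, Z i j ≤ A i j) ∧
      Z.mulVec d = A.mulVec d ∧ ∀ j, ∑ i, Z i j ≤ α := by
  set T := ∑ j, (d j)⁺ with hT
  have hT0 : 0 ≤ T := sum_nonneg fun j _ ↦ posPart_nonneg _
  have hT_neg : ∑ j, (d j)⁻ = T := by
    have : ∑ j, ((d j)⁺ - (d j)⁻) = 0 := by simpa only [posPart_sub_negPart] using hd
    rw [sum_sub_distrib] at this
    linarith
  let m : κ → κ → ℝ := fun j k ↦ (if 0 < d j then (d k)⁻ else (d k)⁺) / T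
  have hm0 : ∀ j k, 0 ≤ m j k := fun j k ↦ by
    dsimp only [m]
    split_ifs
    exacts [div_nonneg (negPart_nonneg _) hT0, div_nonneg (posPart_nonneg _) hT0]
  have hm1 : ∀ j, ∑ k, m j k ≤ 1 := fun j ↦ by
    dsimp only [m]
    split_ifs <;> rw [← sum_div]
    · rw [hT_neg]; exact div_self_le_one T
    · exact div_self_le_one T
  have hmd : ∀ j k, m j k * d j = ((d j)⁺ * (d k)⁻ - (d j)⁻ * (d k)⁺) / T := fun j k ↦ by
    dsimp only [m]
    split_ifs with hj
    · rw [posPart_of_nonneg hj.le, negPart_of_nonneg hj.le]; ring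
    · rw [posPart_of_nonpos (not_lt.1 hj), negPart_of_nonpos (not_lt.1 hj)]; ring
  refine ⟨fun i j ↦ ∑ k, m j k * (A i j - A i k)⁺,
    fun i j ↦ sum_nonneg fun k _ ↦ mul_nonneg (hm0 j k) (posPart_nonneg _), fun i j ↦ ?_, ?_,
    fun j ↦ ?_⟩
  · calc ∑ k, m j k * (A i j - A i k)⁺ ≤ ∑ k, m j k * A i j := by
          refine sum_le_sum fun k _ ↦ mul_le_mul_of_nonneg_left ?_ (hm0 j k)
          exact sup_le (sub_le_self _ (hA i k)) (hA i j)
      _ ≤ A i j := by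
          rw [← sum_mul]
          exact mul_le_of_le_one_left (hA i j) (hm1 j)
  · funext i
    simp only [Matrix.mulVec, dotProduct]
    calc ∑ j, (∑ k, m j k * (A i j - A i k)⁺) * d j
        = ∑ j, ∑ k, ((d j)⁺ * (d k)⁻ / T * (A i j - A i k)⁺
            - (d j)⁻ * (d k)⁺ / T * (A i j - A i k)⁺) := by
          refine sum_congr rfl fun j _ ↦ ?_
          rw [sum_mul]
          refine sum_congr rfl fun k _ ↦ ?_
          rw [mul_right_comm, hmd]
          ring
      _ = ∑ j, ∑ k, ((d j)⁺ * (d k)⁻ / T * (A i j - A i k)⁺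
            - (d j)⁺ * (d k)⁻ / T * (A i k - A i j)⁺) := by
          simp only [sum_sub_distrib]
          congr 1
          rw [sum_comm]
          exact sum_congr rfl fun j _ ↦ sum_congr rfl fun k _ ↦ by ring
      _ = ∑ j, ∑ k, ((d j)⁺ * A i j * ((d k)⁻ / T) - (d j)⁺ / T * ((d k)⁻ * A i k)) := by
          refine sum_congr rfl fun j _ ↦ sum_congr rfl fun k _ ↦ ?_
          have hswap : (A i k - A i j)⁺ = (A i j - A i k)⁺ - (A i j - A i k) := by
            rw [← neg_sub (A i j), posPart_neg]
            linarith [posPart_sub_negPart (A i j - A i k)]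
          rw [hswap]
          ring
      _ = (∑ j, (d j)⁺ * A i j) * (T / T) - T / T * ∑ k, (d k)⁻ * A i k := by
          simp only [sum_sub_distrib, ← mul_sum, ← sum_mul, ← sum_div, hT_neg, ← hT]
      _ = ∑ j, A i j * d j := by
          rcases hT0.eq_or_lt with hT_zero | hT_pos
          · have hp : ∀ j, (d j)⁺ = 0 := fun j ↦
              (sum_eq_zero_iff_of_nonneg fun k _ ↦ posPart_nonneg (d k)).1
                hT_zero.symm j (mem_univ j)
            have hn : ∀ j, (d j)⁻ = 0 := fun j ↦
              (sum_eq_zero_iff_of_nonneg fun k _ ↦ negPart_nonneg (d k)).1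
                (hT_neg.trans hT_zero.symm) j (mem_univ j)
            have hd0 : ∀ j, d j = 0 := fun j ↦ by
              rw [← posPart_sub_negPart (d j), hp, hn, sub_zero]
            simp [hd0]
          · rw [div_self hT_pos.ne', mul_one, one_mul, ← sum_sub_distrib]
            refine sum_congr rfl fun j _ ↦ ?_
            rw [← sub_mul, posPart_sub_negPart, mul_comm]
  · calc ∑ i, ∑ k, m j k * (A i j - A i k)⁺ = ∑ k, m j k * ∑ i, (A i j - A i k)⁺ := by
          rw [sum_comm]
          simp only [mul_sum]
      _ ≤ ∑ k, m j k * α :=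
          sum_le_sum fun k _ ↦ mul_le_mul_of_nonneg_left (hαA j k) (hm0 j k)
      _ ≤ α := by
          rw [← sum_mul]
          exact mul_le_of_le_one_left hα (hm1 j)

/-- generalized data processing lemma: for a column-stochastic matrix `A`
with ergodicity contraction coefficient `ᾱ(A) = (1/2) max_{j,k} ∑ᵢ |a_{ij} − a_{ik}|` and
a normalized convex `h`, the Csiszár–Morimoto divergence contracts:
`H_h(AP‖AQ) ≤ ᾱ(A) H_h(P‖Q)`. -/
theorem generalized_data_processing
    (n : ℕ) (A : Matrix (Fin n) (Fin n) ℝ)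
    (hA0 : ∀ i j, 0 ≤ A i j) (hA1 : ∀ j, ∑ i, A i j = 1)
    (h : ℝ → ℝ) (hconv : ConvexOn ℝ (Set.Ioi 0) h)
    (hnorm1 : h 1 = 0) (hnorm2 : ∀ x : ℝ, 0 < x → 0 ≤ h x)
    (P Q : Fin n → ℝ)
    (hP : ∀ i, 0 < P i) (hQ : ∀ i, 0 < Q i)
    (hP1 : ∑ i, P i = 1) (hQ1 : ∑ i, Q i = 1)
    (hAP : ∀ i, 0 < A.mulVec P i) (hAQ : ∀ i, 0 < A.mulVec Q i) :
    ∑ i, A.mulVec Q i * h (A.mulVec P i / A.mulVec Q i)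
      ≤ ((1 : ℝ) / 2 * ⨆ j, ⨆ k, ∑ i, |A i j - A i k|) * ∑ i, Q i * h (P i / Q i) := by
  set α : ℝ := 1 / 2 * ⨆ j, ⨆ k, ∑ i, |A i j - A i k|
  have hα : 0 ≤ α := mul_nonneg (by norm_num) <| Real.iSup_nonneg fun j ↦
    Real.iSup_nonneg fun k ↦ sum_nonneg fun i _ ↦ abs_nonneg _
  have hαA : ∀ j k, ∑ i, (A i j - A i k)⁺ ≤ α := fun j k ↦ by
    rw [sum_posPart_sub_eq_half_sum_abs ((hA1 j).trans (hA1 k).symm)]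
    refine mul_le_mul_of_nonneg_left ?_ (by norm_num)
    exact (le_ciSup (f := fun k ↦ ∑ i, |A i j - A i k|) (Set.finite_range _).bddAbove k).trans
      (le_ciSup (f := fun j ↦ ⨆ k, ∑ i, |A i j - A i k|) (Set.finite_range _).bddAbove j)
  obtain ⟨Z, hZ0, hZA, hZd, hZα⟩ := Matrix.exists_le_mulVec_eq_of_sum_eq_zero hA0 (d := P - Q)
    (by simp [hP1, hQ1]) hα hαA
  calc ∑ i, A.mulVec Q i * h (A.mulVec P i / A.mulVec Q i)
      ≤ ∑ i, ∑ j, Z i j * Q j * h (P j / Q j) := by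
        refine sum_le_sum fun i _ ↦ hconv.mul_map_div_le_sum_of_map_one_eq_zero hnorm1
          (fun j ↦ mul_nonneg (hZ0 i j) (hQ j).le) (fun j ↦ div_pos (hP j) (hQ j)) (hAQ i)
          (sum_le_sum fun j _ ↦ mul_le_mul_of_nonneg_right (hZA i j) (hQ j).le) ?_
        rw [← Pi.sub_apply, ← Matrix.mulVec_sub, ← hZd]
        refine sum_congr rfl fun j _ ↦ ?_
        rw [Pi.sub_apply, mul_assoc, mul_sub, mul_div_cancel₀ _ (hQ j).ne', mul_one]
    _ = ∑ j, (∑ i, Z i j) * (Q j * h (P j / Q j)) := by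
        rw [sum_comm]
        simp only [sum_mul, mul_assoc]
    _ ≤ α * ∑ j, Q j * h (P j / Q j) := by
        rw [mul_sum]
        exact sum_le_sum fun j _ ↦ mul_le_mul_of_nonneg_right (hZα j)
          (mul_nonneg (hQ j).le (hnorm2 _ (div_pos (hP j) (hQ j))))
end

section
/- Let P, Q, U, V be positive probability distributions on n states. Suppose that for every convex function h : (0,∞) → ℝ with h(1) = 0 and h(x) ≥ 0 for all x > 0, the contraction inequality H_h(U‖V) ≤ H_h(P‖Q) holds, where H_h(P‖Q) = Σ_i q_i h(p_i/q_i). Then there exists a column-stochastic matrix A (entries nonnegative, each column summing to 1) such that U = AP and V = AQ. -/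
open Finset

/-- A finite maximum of affine functions is convex. -/
theorem convexOn_sup'_affine {ι : Type*} (t : Finset ι) (ht : t.Nonempty) (a b : ι → ℝ)
    {s : Set ℝ} (hs : Convex ℝ s) :
    ConvexOn ℝ s (fun x => t.sup' ht fun i => a i * x + b i) := by
  refine ⟨hs, fun x _ y _ α β hα hβ hαβ => ?_⟩
  refine Finset.sup'_le _ _ fun i hi => ?_
  have hx := Finset.le_sup' (fun i => a i * x + b i) hi
  have hy := Finset.le_sup' (fun i => a i * y + b i) hi
  have hb : b i = (α + β) * b i := by rw [hαβ, one_mul]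
  have h1 := mul_le_mul_of_nonneg_left hx hα
  have h2 := mul_le_mul_of_nonneg_left hy hβ
  simp only [smul_eq_mul] at *
  linarith

/-- A continuous linear functional on `ℝⁿ × ℝⁿ` in coordinates. -/
theorem continuousLinearMap_prod_pi_apply {ι : Type*} [Fintype ι] [DecidableEq ι]
    (f : ((ι → ℝ) × (ι → ℝ)) →L[ℝ] ℝ) (x y : ι → ℝ) :
    f (x, y) = ∑ i, (f (Pi.single i 1, 0) * x i + f (0, Pi.single i 1) * y i) := by
  have h : f (x, y) = f.comp (.inl ℝ _ _) x + f.comp (.inr ℝ _ _) y := by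
    simp [← map_add]
  rw [h, ← ContinuousLinearMap.coe_coe, ← ContinuousLinearMap.coe_coe,
    LinearMap.pi_apply_eq_sum_univ, LinearMap.pi_apply_eq_sum_univ, ← Finset.sum_add_distrib]
  refine Finset.sum_congr rfl fun i _ => ?_
  have hi : (fun j => if i = j then (1 : ℝ) else 0) = Pi.single i 1 := by
    ext j
    simp [Pi.single_apply, eq_comm]
  simp [hi, mul_comm]

/-- The combination of a family of column vectors with weights `w`, that is, `B ↦ Bᵀ w`. -/
def columnCombination {ι : Type*} [Fintype ι] (w : ι → ℝ) : (ι → ι → ℝ) →ₗ[ℝ] (ι → ℝ) :=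
  ∑ j, w j • LinearMap.proj j

theorem columnCombination_apply {ι : Type*} [Fintype ι] (w : ι → ℝ) (B : ι → ι → ℝ) (i : ι) :
    columnCombination w B i = ∑ j, w j * B j i := by
  simp [columnCombination]

/-- If no column-stochastic matrix maps `(P, Q)` to `(U, V)`, then some pair of coefficient
vectors `(a, b)` strictly separates `(U, V)` from the images of `(P, Q)` under all
deterministic column-stochastic matrices. -/
theorem exists_separating_of_not_exists_stochastic {ι : Type*} [Fintype ι] [DecidableEq ι]
    (P Q U V : ι → ℝ)
    (hA : ¬ ∃ A : Matrix ι ι ℝ, (∀ i j, 0 ≤ A i j) ∧ (∀ j, ∑ i, A i j = 1) ∧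
      U = A.mulVec P ∧ V = A.mulVec Q) :
    ∃ a b : ι → ℝ, ∀ m : ι → ι,
      ∑ j, (a (m j) * P j + b (m j) * Q j) < ∑ i, (a i * U i + b i * V i) := by
  set K : Set (ι → ι → ℝ) := Set.univ.pi fun _ => stdSimplex ℝ ι
  set L := (columnCombination P).prod (columnCombination Q)
  have hK : IsCompact K := isCompact_univ_pi fun _ => isCompact_stdSimplex ℝ ι
  have hKc : Convex ℝ K := convex_pi fun _ _ => convex_stdSimplex ℝ ι
  have hnot : (U, V) ∉ L '' K := by
    rintro ⟨B, hB, hBL⟩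
    obtain ⟨hU, hV⟩ := Prod.ext_iff.mp hBL
    refine hA ⟨Matrix.of fun i j => B j i, fun i j => (hB j trivial).1 i,
      fun j => (hB j trivial).2, hU.symm.trans ?_, hV.symm.trans ?_⟩ <;>
    · ext i
      simp [L, columnCombination_apply, Matrix.mulVec, dotProduct, mul_comm]
  obtain ⟨f, u, hf, hu⟩ := geometric_hahn_banach_closed_point (hKc.linear_image L)
    (hK.image L.continuous_of_finiteDimensional).isClosed hnot
  refine ⟨fun i => f (Pi.single i 1, 0), fun i => f (0, Pi.single i 1), fun m => ?_⟩
  have hm : (fun j => Pi.single (m j) (1 : ℝ)) ∈ K := fun j _ => single_mem_stdSimplex ℝ (m j)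
  have h := (hf _ ⟨_, hm, rfl⟩).trans hu
  rw [continuousLinearMap_prod_pi_apply f U V] at h
  refine lt_of_eq_of_lt (Eq.symm ?_) h
  change f (columnCombination P _, columnCombination Q _) = _
  rw [continuousLinearMap_prod_pi_apply]
  simp only [columnCombination_apply, Finset.mul_sum, ← Finset.sum_add_distrib]
  rw [Finset.sum_comm]
  refine Finset.sum_congr rfl fun j _ => ?_
  simp [Pi.single_apply, Finset.sum_add_distrib]

/-- converse generalized data processing lemma: if
`H_h(U‖V) ≤ H_h(P‖Q)` for every normalized convex `h` on `(0,∞)`, then there exists a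
column-stochastic matrix `A` with `U = AP` and `V = AQ`. -/
theorem converse_generalized_data_processing
    (n : ℕ) (P Q U V : Fin n → ℝ)
    (hP : ∀ i, 0 < P i) (hQ : ∀ i, 0 < Q i) (hU : ∀ i, 0 < U i) (hV : ∀ i, 0 < V i)
    (hP1 : ∑ i, P i = 1) (hQ1 : ∑ i, Q i = 1) (hU1 : ∑ i, U i = 1) (hV1 : ∑ i, V i = 1)
    (hcontr : ∀ h : ℝ → ℝ, ConvexOn ℝ (Set.Ioi 0) h → h 1 = 0 →
      (∀ x : ℝ, 0 < x → 0 ≤ h x) →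
      ∑ i, V i * h (U i / V i) ≤ ∑ i, Q i * h (P i / Q i)) :
    ∃ A : Matrix (Fin n) (Fin n) ℝ,
      (∀ i j, 0 ≤ A i j) ∧ (∀ j, ∑ i, A i j = 1) ∧
      U = A.mulVec P ∧ V = A.mulVec Q := by
  by_contra hA
  obtain ⟨a, b, hab⟩ := exists_separating_of_not_exists_stochastic P Q U V hA
  have hne : (univ : Finset (Fin n)).Nonempty := by
    by_contra hempty
    simp [Finset.not_nonempty_iff_eq_empty.mp hempty] at hP1
  obtain ⟨k, -, hk⟩ := Finset.exists_max_image univ (fun i => a i + b i) hne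
  set h : ℝ → ℝ := fun x => univ.sup' hne fun i => (a i - a k) * x + (b i - b k)
  have hle (x : ℝ) (i : Fin n) : (a i - a k) * x + (b i - b k) ≤ h x :=
    Finset.le_sup' (fun i => (a i - a k) * x + (b i - b k)) (mem_univ i)
  have hnonneg (x : ℝ) : 0 ≤ h x := by simpa using hle x k
  have hone : h 1 = 0 := by
    refine le_antisymm (Finset.sup'_le _ _ fun i hi => ?_) (hnonneg 1)
    linarith [hk i hi]
  have hdiv := hcontr h (convexOn_sup'_affine univ hne _ _ (convex_Ioi 0)) hone
    fun x _ => hnonneg x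
  have hmax (j : Fin n) : ∃ i, h (P j / Q j) = (a i - a k) * (P j / Q j) + (b i - b k) := by
    obtain ⟨i, -, hi⟩ := Finset.exists_mem_eq_sup' hne
      fun i => (a i - a k) * (P j / Q j) + (b i - b k)
    exact ⟨i, hi⟩
  choose m hm using hmax
  have hright : ∑ j, Q j * h (P j / Q j) =
      ∑ j, (a (m j) * P j + b (m j) * Q j) - (a k + b k) := by
    have hterm (j : Fin n) : Q j * h (P j / Q j) =
        a (m j) * P j + b (m j) * Q j - (a k * P j + b k * Q j) := by
      have := (hQ j).ne'
      rw [hm]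
      field_simp
      ring
    simp only [hterm, Finset.sum_sub_distrib]
    simp only [Finset.sum_add_distrib, ← Finset.mul_sum, hP1, hQ1, mul_one]
  have hleft : ∑ i, (a i * U i + b i * V i) - (a k + b k) ≤ ∑ i, V i * h (U i / V i) := by
    have hterm (i : Fin n) :
        a i * U i + b i * V i - (a k * U i + b k * V i) ≤ V i * h (U i / V i) := by
      have := (hV i).ne'
      refine le_of_eq_of_le ?_ (mul_le_mul_of_nonneg_left (hle (U i / V i) i) (hV i).le)
      field_simp
      ring
    refine le_of_eq_of_le ?_ (Finset.sum_le_sum fun i _ => hterm i)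
    rw [Finset.sum_sub_distrib, Finset.sum_add_distrib (f := fun i => a k * U i),
      ← Finset.mul_sum, ← Finset.mul_sum, hU1, hV1, mul_one, mul_one]
  linarith [hab m]
end

section
/- Let P* be a positive probability distribution on n states, let q_{ij} ≥ 0 (i ≠ j) satisfy Σ_{j≠i} q_{ij} p*_j = (Σ_{j≠i} q_{ji}) p*_i for all i, and let P(t), t ∈ [0,T], be a solution of the master equation dp_i/dt = Σ_{j≠i} q_{ij} p*_j (p_j/p*_j − p_i/p*_i) consisting of positive probability distributions. Then the function t ↦ max_{i=1,…,n} p_i(t)/p*_i is nonincreasing on [0,T]; in particular, the relative Min-entropy H_∞(P‖P*) = ln max_i (p_i/p*_i) is a Lyapunov function for every Markov chain with equilibrium P*. -/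
open Finset Filter Topology

/-- A finite supremum of differentiable functions is nonincreasing on an interval as soon as,
at each point, the functions attaining the supremum have nonpositive derivative. -/
theorem antitoneOn_iSup_of_deriv_nonpos_of_eq_iSup {ι : Type*} [Finite ι] [Nonempty ι]
    {u u' : ι → ℝ → ℝ} {a b : ℝ}
    (hu : ∀ t ∈ Set.Icc a b, ∀ i, HasDerivAt (u i) (u' i t) t)
    (hmax : ∀ t ∈ Set.Icc a b, ∀ i, u i t = ⨆ j, u j t → u' i t ≤ 0) :
    AntitoneOn (fun t => ⨆ i, u i t) (Set.Icc a b) := by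
  have := Fintype.ofFinite ι
  have hbdd (t : ℝ) : BddAbove (Set.range fun i => u i t) := Set.finite_range _ |>.bddAbove
  intro s hs t ht hst
  have hsub : Set.Icc s t ⊆ Set.Icc a b := Set.Icc_subset_Icc hs.1 ht.2
  have hcont : ContinuousOn (fun t => ⨆ i, u i t) (Set.Icc s t) := by
    simp_rw [← Finset.sup'_univ_eq_ciSup]
    exact ContinuousOn.finset_sup'_apply _ fun i _ x hx =>
      (hu x (hsub hx) i).continuousAt.continuousWithinAt
  refine image_le_of_liminf_slope_right_le_deriv_boundary (B := fun _ => ⨆ i, u i s)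
    (B' := fun _ => 0) hcont le_rfl continuousOn_const
    (fun x _ => hasDerivWithinAt_const x _ _) ?_ (Set.right_mem_Icc.2 hst)
  intro x hx r hr
  have hx' := hsub (Set.Ico_subset_Icc_self hx)
  have hlt (i : ι) : ∀ᶠ z in 𝓝[>] x, u i z < (⨆ j, u j x) + r * (z - x) := by
    rcases (le_ciSup (hbdd x) i).eq_or_lt with h | h
    · filter_upwards [(hu x hx' i).hasDerivWithinAt.limsup_slope_le' Set.self_notMem_Ioi
        ((hmax x hx' i h).trans_lt hr), self_mem_nhdsWithin] with z hz hxz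
      rw [slope_def_field, div_lt_iff₀ (sub_pos.2 hxz)] at hz
      linarith
    · filter_upwards [(hu x hx' i).continuousAt.continuousWithinAt.eventually_lt_const h,
        self_mem_nhdsWithin] with z hz hxz
      have := mul_pos hr (sub_pos.2 hxz)
      linarith
  refine Eventually.frequently ?_
  filter_upwards [eventually_all.2 hlt, self_mem_nhdsWithin] with z hz hxz
  obtain ⟨i, hi⟩ := exists_eq_ciSup_of_finite (f := fun i => u i z)
  rw [slope_def_field, div_lt_iff₀ (sub_pos.2 hxz), ← hi]
  linarith [hz i]

/-- along every solution of the master equation of a Markov chain with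
positive equilibrium `pstar`, the function `max_i pᵢ(t)/p*ᵢ` is nonincreasing; in
particular the relative Min-entropy `ln max_i (pᵢ/p*ᵢ)` is a Lyapunov function. -/
theorem min_entropy_lyapunov
    (n : ℕ) (pstar : Fin n → ℝ) (hps : ∀ i, 0 < pstar i) (hps1 : ∑ i, pstar i = 1)
    (q : Fin n → Fin n → ℝ) (hq : ∀ i j, i ≠ j → 0 ≤ q i j)
    (hbal : ∀ i, ∑ j ∈ Finset.univ.erase i, q i j * pstar j
        = (∑ j ∈ Finset.univ.erase i, q j i) * pstar i)
    (T : ℝ) (hT : 0 ≤ T) (p : ℝ → Fin n → ℝ)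
    (hprob : ∀ t ∈ Set.Icc (0:ℝ) T, (∀ i, 0 < p t i) ∧ ∑ i, p t i = 1)
    (hsol : ∀ t ∈ Set.Icc (0:ℝ) T, ∀ i, HasDerivAt (fun s => p s i)
      (∑ j ∈ Finset.univ.erase i,
        q i j * pstar j * (p t j / pstar j - p t i / pstar i)) t) :
    AntitoneOn (fun t => ⨆ i, p t i / pstar i) (Set.Icc (0:ℝ) T) ∧
    AntitoneOn (fun t => Real.log (⨆ i, p t i / pstar i)) (Set.Icc (0:ℝ) T) := by
  have : Nonempty (Fin n) := by
    by_contra h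
    rw [not_nonempty_iff] at h
    simp at hps1
  have hbdd (t : ℝ) : BddAbove (Set.range fun i => p t i / pstar i) :=
    (Set.finite_range _).bddAbove
  have hanti : AntitoneOn (fun t => ⨆ i, p t i / pstar i) (Set.Icc (0:ℝ) T) := by
    refine antitoneOn_iSup_of_deriv_nonpos_of_eq_iSup
      (fun t ht i => (hsol t ht i).div_const (pstar i)) fun t _ i hi => ?_
    refine div_nonpos_of_nonpos_of_nonneg (Finset.sum_nonpos fun j hj => ?_) (hps i).le
    refine mul_nonpos_of_nonneg_of_nonpos
      (mul_nonneg (hq i j (Finset.ne_of_mem_erase hj).symm) (hps j).le) (sub_nonpos.2 ?_)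
    exact hi ▸ le_ciSup (hbdd t) j
  refine ⟨hanti, fun s hs t ht hst => Real.log_le_log ?_ (hanti hs ht hst)⟩
  let i := Classical.arbitrary (Fin n)
  exact (div_pos ((hprob t ht).1 i) (hps i)).trans_le (le_ciSup (hbdd t) i)
end
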